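/- arXiv:1803.10639 — 8 statements merged into one kernel-verified Lean document; each statement's English description precedes it below -/
import Mathlib

section
/- Let G = (V,E) be a simple graph with n vertices and exactly m edges, let 0 ≤ p ≤ 1, let r ≥ 0, and let Q be a p-random query. Let u ≠ v be vertices of G with {u,v} ∉ E. Then: (1) if |Γ_G({u,v})| ≤ r, the probability that u ∈ Q, v ∈ Q and Q is independent in G is at least p²(1 − rp − mp²); (2) if |Γ_G({u,v})| ≥ r, the probability that u ∈ Q, v ∈ Q and Q is independent in G is at most p²(1 − p)^r. -/
open Finset
open scoped Classical

/-- The probability that a `p`-random query (each vertex included independently with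
probability `p`) equals the given finite set `Q`. -/
noncomputable def qweight {V : Type} [Fintype V] (p : ℝ) (Q : Finset V) : ℝ :=
  p ^ Q.card * (1 - p) ^ (Fintype.card V - Q.card)

/-- The probability that a `p`-random query satisfies the event `A`. -/
noncomputable def qprob {V : Type} [Fintype V] (p : ℝ) (A : Finset V → Prop) : ℝ :=
  ∑ Q : Finset V, if A Q then qweight p Q else 0

/-- `Q` is an independent set in `G` (the edge-detecting query `Q` is answered "NO"). -/
def indepIn {V : Type} (G : SimpleGraph V) (Q : Finset V) : Prop :=
  ∀ u ∈ Q, ∀ v ∈ Q, ¬ G.Adj u v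

/-- `Γ_G(S)`: the set of vertices outside `S` adjacent in `G` to some vertex of `S`. -/
noncomputable def nbrs {V : Type} [Fintype V] (G : SimpleGraph V) (S : Finset V) : Finset V :=
  Finset.univ.filter fun u => u ∉ S ∧ ∃ v ∈ S, G.Adj u v

theorem qweight_nonneg {V : Type} [Fintype V] {p : ℝ} (hp0 : 0 ≤ p) (hp1 : p ≤ 1)
    (Q : Finset V) : 0 ≤ qweight p Q :=
  mul_nonneg (pow_nonneg hp0 _) (pow_nonneg (sub_nonneg.2 hp1) _)

theorem qprob_mono {V : Type} [Fintype V] {p : ℝ} (hp0 : 0 ≤ p) (hp1 : p ≤ 1)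
    {A B : Finset V → Prop} (h : ∀ Q, A Q → B Q) : qprob p A ≤ qprob p B := by
  refine Finset.sum_le_sum fun Q _ => ?_
  have := qweight_nonneg hp0 hp1 Q
  by_cases hA : A Q
  · simp [hA, h Q hA]
  · rw [if_neg hA]
    split_ifs <;> simp [this]

theorem qprob_or_le {V : Type} [Fintype V] {p : ℝ} (hp0 : 0 ≤ p) (hp1 : p ≤ 1)
    (A B : Finset V → Prop) : qprob p (fun Q => A Q ∨ B Q) ≤ qprob p A + qprob p B := by
  unfold qprob
  rw [← Finset.sum_add_distrib]
  refine Finset.sum_le_sum fun Q _ => ?_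
  have := qweight_nonneg hp0 hp1 Q
  by_cases hA : A Q <;> by_cases hB : B Q <;> simp [hA, hB, this]

theorem qprob_exists_le {V ι : Type} [Fintype V] {p : ℝ} (hp0 : 0 ≤ p) (hp1 : p ≤ 1)
    (s : Finset ι) (A : ι → Finset V → Prop) :
    qprob p (fun Q => ∃ i ∈ s, A i Q) ≤ ∑ i ∈ s, qprob p (A i) := by
  induction s using Finset.induction_on with
  | empty => simp [qprob]
  | insert a s ha ih =>
    rw [Finset.sum_insert ha]
    calc qprob p (fun Q => ∃ i ∈ insert a s, A i Q)
        ≤ qprob p (fun Q => A a Q ∨ ∃ i ∈ s, A i Q) :=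
          qprob_mono hp0 hp1 fun Q h => by simpa using h
      _ ≤ qprob p (A a) + qprob p (fun Q => ∃ i ∈ s, A i Q) := qprob_or_le hp0 hp1 _ _
      _ ≤ _ := by gcongr

/-- A `p`-random query contains `S` and misses a disjoint set `T` with probability
`p ^ |S| * (1 - p) ^ |T|`. -/
theorem qprob_subset_and_disjoint {V : Type} [Fintype V] (p : ℝ) {S T : Finset V}
    (hST : Disjoint S T) :
    qprob p (fun Q => S ⊆ Q ∧ Disjoint T Q) = p ^ S.card * (1 - p) ^ T.card := by
  have hexp := Finset.prod_add (fun i => if i ∈ T then 0 else p)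
    (fun i => if i ∈ S then 0 else 1 - p) (Finset.univ : Finset V)
  have hprod : ∏ i : V, ((if i ∈ T then 0 else p) + (if i ∈ S then 0 else 1 - p))
      = p ^ S.card * (1 - p) ^ T.card := by
    have hfac : ∀ i : V, ((if i ∈ T then 0 else p) + (if i ∈ S then 0 else 1 - p))
        = (if i ∈ S then p else 1) * (if i ∈ T then 1 - p else 1) := by
      intro i
      by_cases hS : i ∈ S
      · simp [hS, Finset.disjoint_left.1 hST hS]
      · by_cases hT : i ∈ T <;> simp [hS, hT]
    simp_rw [hfac]
    rw [Finset.prod_mul_distrib]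
    simp
  rw [← hprod, hexp, Finset.powerset_univ]
  refine Finset.sum_congr rfl fun Q _ => ?_
  split_ifs with h
  · rw [Finset.prod_congr rfl (g := fun _ => p) fun i hi =>
        if_neg fun hT => Finset.disjoint_left.1 h.2 hT hi,
      Finset.prod_congr rfl (g := fun _ => 1 - p) fun i hi =>
        if_neg fun hS => (Finset.mem_sdiff.1 hi).2 (h.1 hS)]
    simp [qweight, Finset.card_sdiff_of_subset (Finset.subset_univ Q)]
  · rw [not_and_or, Finset.not_subset, Finset.not_disjoint_iff] at h
    obtain ⟨i, hS, hQ⟩ | ⟨i, hT, hQ⟩ := h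
    · rw [Finset.prod_eq_zero (i := i) (s := Finset.univ \ Q) (by simp [hQ]) (by simp [hS]),
        mul_zero]
    · rw [Finset.prod_eq_zero (i := i) (s := Q) hQ (by simp [hT]), zero_mul]

theorem qprob_subset {V : Type} [Fintype V] (p : ℝ) (S : Finset V) :
    qprob p (fun Q => S ⊆ Q) = p ^ S.card := by
  simpa using qprob_subset_and_disjoint p (Finset.disjoint_empty_right S)

/-- A query containing `S` that is not independent contains a neighbour of `S` or an edge
avoiding `S`, provided `S` is independent. -/
theorem exists_mem_nbrs_or_edge_of_not_indepIn {V : Type} [Fintype V] {G : SimpleGraph V}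
    {S Q : Finset V} (hS : indepIn G S) (hQ : ¬ indepIn G Q) :
    (∃ w ∈ nbrs G S, w ∈ Q) ∨
      ∃ e ∈ G.edgeFinset.filter (fun e => Disjoint S e.toFinset), e.toFinset ⊆ Q := by
  simp only [indepIn, not_forall, not_not] at hQ
  obtain ⟨a, ha, b, hb, hab⟩ := hQ
  by_cases haS : a ∈ S
  · have hbS : b ∉ S := fun h => hS a haS b h hab
    exact Or.inl ⟨b, by simpa [nbrs, hbS] using ⟨a, haS, hab.symm⟩, hb⟩
  by_cases hbS : b ∈ S
  · exact Or.inl ⟨a, by simpa [nbrs, haS] using ⟨b, hbS, hab⟩, ha⟩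
  · refine Or.inr ⟨s(a, b), ?_, ?_⟩
    · refine Finset.mem_filter.2 ⟨by simpa using hab, Finset.disjoint_right.2 fun x hx => ?_⟩
      obtain rfl | rfl := Sym2.mem_iff.1 (Sym2.mem_toFinset.1 hx)
      exacts [haS, hbS]
    · intro x hx
      obtain rfl | rfl := Sym2.mem_iff.1 (Sym2.mem_toFinset.1 hx)
      exacts [ha, hb]

theorem le_qprob_subset_and_indepIn {V : Type} [Fintype V] {G : SimpleGraph V} {p : ℝ}
    (hp0 : 0 ≤ p) (hp1 : p ≤ 1) {S : Finset V} (hS : indepIn G S) :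
    p ^ S.card * (1 - (nbrs G S).card * p - G.edgeFinset.card * p ^ 2) ≤
      qprob p (fun Q => S ⊆ Q ∧ indepIn G Q) := by
  set E := G.edgeFinset.filter (fun e => Disjoint S e.toFinset) with hE
  have hcover : p ^ S.card ≤ qprob p (fun Q => S ⊆ Q ∧ indepIn G Q) +
      (∑ w ∈ nbrs G S, qprob p (fun Q => insert w S ⊆ Q) +
        ∑ e ∈ E, qprob p (fun Q => S ∪ e.toFinset ⊆ Q)) := by
    rw [← qprob_subset]
    refine (qprob_mono hp0 hp1 (B := fun Q => (S ⊆ Q ∧ indepIn G Q) ∨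
      ((∃ w ∈ nbrs G S, insert w S ⊆ Q) ∨ ∃ e ∈ E, S ∪ e.toFinset ⊆ Q)) fun Q hSQ => ?_).trans ?_
    · by_cases hQ : indepIn G Q
      · exact Or.inl ⟨hSQ, hQ⟩
      · refine Or.inr ((exists_mem_nbrs_or_edge_of_not_indepIn hS hQ).imp ?_ ?_)
        · rintro ⟨w, hw, hwQ⟩
          exact ⟨w, hw, Finset.insert_subset hwQ hSQ⟩
        · rintro ⟨e, he, heQ⟩
          exact ⟨e, he, Finset.union_subset hSQ heQ⟩
    · refine (qprob_or_le hp0 hp1 _ _).trans (add_le_add le_rfl ?_)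
      exact (qprob_or_le hp0 hp1 _ _).trans
        (add_le_add (qprob_exists_le hp0 hp1 _ _) (qprob_exists_le hp0 hp1 _ _))
  have hnbr : ∑ w ∈ nbrs G S, qprob p (fun Q => insert w S ⊆ Q) =
      (nbrs G S).card * p ^ (S.card + 1) := by
    rw [← nsmul_eq_mul]
    refine Finset.sum_eq_card_nsmul fun w hw => ?_
    rw [qprob_subset, Finset.card_insert_of_notMem (Finset.mem_filter.1 hw).2.1]
  have hedge : ∑ e ∈ E, qprob p (fun Q => S ∪ e.toFinset ⊆ Q) = E.card * p ^ (S.card + 2) := by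
    rw [← nsmul_eq_mul]
    refine Finset.sum_eq_card_nsmul fun e he => ?_
    obtain ⟨heG, hdisj⟩ := Finset.mem_filter.1 he
    rw [qprob_subset, Finset.card_union_of_disjoint hdisj, Sym2.card_toFinset_of_not_isDiag e
      (G.not_isDiag_of_mem_edgeFinset heG)]
  have hcard : (E.card : ℝ) * p ^ (S.card + 2) ≤ G.edgeFinset.card * p ^ (S.card + 2) := by
    gcongr
    exact Finset.filter_subset _ _
  rw [hnbr, hedge] at hcover
  linarith [show p ^ S.card * (1 - (nbrs G S).card * p - G.edgeFinset.card * p ^ 2) =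
    p ^ S.card - (nbrs G S).card * p ^ (S.card + 1) - G.edgeFinset.card * p ^ (S.card + 2) by
      ring]

theorem qprob_subset_and_indepIn_le {V : Type} [Fintype V] {G : SimpleGraph V} {p : ℝ}
    (hp0 : 0 ≤ p) (hp1 : p ≤ 1) (S : Finset V) :
    qprob p (fun Q => S ⊆ Q ∧ indepIn G Q) ≤ p ^ S.card * (1 - p) ^ (nbrs G S).card := by
  have hdisj : Disjoint S (nbrs G S) :=
    Finset.disjoint_right.2 fun w hw => (Finset.mem_filter.1 hw).2.1
  rw [← qprob_subset_and_disjoint p hdisj]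
  refine qprob_mono hp0 hp1 fun Q hQ => ⟨hQ.1, Finset.disjoint_left.2 fun w hw hwQ => ?_⟩
  obtain ⟨x, hx, hwx⟩ := (Finset.mem_filter.1 hw).2.2
  exact hQ.2 w hwQ x (hQ.1 hx) hwx

theorem stmt0 {V : Type} [Fintype V] [DecidableEq V]
    (G : SimpleGraph V) [DecidableRel G.Adj]
    (m : ℕ) (hm : G.edgeFinset.card = m)
    (p r : ℝ) (hp0 : 0 ≤ p) (hp1 : p ≤ 1) (hr : 0 ≤ r)
    (u v : V) (huv : u ≠ v) (hne : ¬ G.Adj u v) :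
    (((nbrs G {u, v}).card : ℝ) ≤ r →
      p ^ 2 * (1 - r * p - m * p ^ 2) ≤
        qprob p (fun Q => u ∈ Q ∧ v ∈ Q ∧ indepIn G Q)) ∧
    ((r ≤ ((nbrs G {u, v}).card : ℝ)) →
      qprob p (fun Q => u ∈ Q ∧ v ∈ Q ∧ indepIn G Q) ≤ p ^ 2 * (1 - p) ^ r) := by
  have hindep : indepIn G {u, v} := by
    have hne' : ¬ G.Adj v u := fun h => hne h.symm
    simp [indepIn, hne, hne']
  have hcard : ({u, v} : Finset V).card = 2 := Finset.card_pair huv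
  have hevent : (fun Q : Finset V => u ∈ Q ∧ v ∈ Q ∧ indepIn G Q) =
      fun Q => ({u, v} : Finset V) ⊆ Q ∧ indepIn G Q := by
    funext Q
    simp [Finset.insert_subset_iff, and_assoc]
  have hlower := le_qprob_subset_and_indepIn hp0 hp1 hindep
  have hupper := qprob_subset_and_indepIn_le (G := G) hp0 hp1 {u, v}
  rw [hcard] at hlower hupper
  have hm' : (G.edgeFinset.card : ℝ) = m := by exact_mod_cast hm
  rw [hevent]
  refine ⟨fun h => le_trans ?_ hlower, fun h => hupper.trans ?_⟩
  · rw [← hm']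
    gcongr
  · rw [← Real.rpow_natCast (1 - p)]
    exact mul_le_mul_of_nonneg_left
      (Real.rpow_le_rpow_of_exponent_ge' (sub_nonneg.2 hp1) (by linarith) hr h) (sq_nonneg p)
end

section
/- Let G = (V,E) be a simple graph with n ≥ 2 vertices and m edges, let 0 ≤ p ≤ 1, r ≥ 0 and δ ∈ (0,1) be such that p²(1 − rp − mp²) > 0, and let t be an integer with t ≥ (2 ln n + ln(1/δ))/(p²(1 − rp − mp²)). Let Q_1, …, Q_t be independent p-random queries. Say that a pair {u,v} ∉ E of distinct vertices survives if there is no index i ∈ [t] with u ∈ Q_i, v ∈ Q_i and Q_i independent in G. Then the probability that some non-edge {u,v} with |Γ_G({u,v})| ≤ r survives is at most n²(1 − p²(1 − rp − mp²))^t ≤ δ, and the expected number of surviving non-edges {u,v} with |Γ_G({u,v})| ≤ r is at most δ. -/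
open Finset
open scoped Classical

/-- The probability that `t` independent `p`-random queries satisfy the event `A`. -/
noncomputable def qprobT {V : Type} [Fintype V] (p : ℝ) (t : ℕ)
    (A : (Fin t → Finset V) → Prop) : ℝ :=
  ∑ Qs : Fin t → Finset V, if A Qs then ∏ i, qweight p (Qs i) else 0

/-- The expectation of `f` over `t` independent `p`-random queries. -/
noncomputable def qexpT {V : Type} [Fintype V] (p : ℝ) (t : ℕ)
    (f : (Fin t → Finset V) → ℝ) : ℝ :=
  ∑ Qs : Fin t → Finset V, (∏ i, qweight p (Qs i)) * f Qs

/-- The pair `{u,v}` survives the queries `Qs`: no query contains both `u` and `v` and is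
independent in `G`. -/
def survives {V : Type} (G : SimpleGraph V) {t : ℕ} (Qs : Fin t → Finset V) (u v : V) : Prop :=
  ¬ ∃ i, u ∈ Qs i ∧ v ∈ Qs i ∧ indepIn G (Qs i)

theorem sum_qweight_superset {V : Type} [Fintype V] [DecidableEq V] (p : ℝ) (S : Finset V) :
    ∑ Q : Finset V, (if S ⊆ Q then qweight p Q else 0) = p ^ S.card := by
  have h := Finset.prod_add (fun _ : V => p) (fun i => if i ∈ S then 0 else 1 - p) Finset.univ
  have hl : ∏ i : V, (p + if i ∈ S then 0 else 1 - p) = p ^ S.card := by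
    have : ∀ i : V, (p + if i ∈ S then 0 else 1 - p) = if i ∈ S then p else 1 := by
      intro i; split_ifs <;> ring
    simp [this]
  rw [hl] at h
  rw [h, Finset.powerset_univ]
  refine Finset.sum_congr rfl fun Q _ => ?_
  split_ifs with hS
  · have : ∏ i ∈ Finset.univ \ Q, (if i ∈ S then 0 else 1 - p)
        = ∏ _i ∈ Finset.univ \ Q, (1 - p) := by
      refine Finset.prod_congr rfl fun i hi => if_neg fun hiS => ?_
      exact (Finset.mem_sdiff.1 hi).2 (hS hiS)
    rw [this, Finset.prod_const, Finset.prod_const, qweight,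
      Finset.card_sdiff_of_subset (Finset.subset_univ Q), Finset.card_univ]
  · obtain ⟨i, hiS, hiQ⟩ := Finset.not_subset.1 hS
    rw [Finset.prod_eq_zero (i := i) (s := Finset.univ \ Q) (by simp [hiQ]) (by simp [hiS]),
      mul_zero]

theorem sum_qweight {V : Type} [Fintype V] (p : ℝ) : ∑ Q : Finset V, qweight p Q = 1 := by
  simpa using sum_qweight_superset p (∅ : Finset V)

/-- A query containing a non-edge `{u,v}` that is not independent contains a neighbour of
`{u,v}` or an edge disjoint from `{u,v}`. -/
theorem nbr_or_edge_of_not_indepIn {V : Type} [Fintype V] [DecidableEq V] (G : SimpleGraph V)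
    [DecidableRel G.Adj] {u v : V} (huv : ¬ G.Adj u v) {Q : Finset V} (hu : u ∈ Q) (hv : v ∈ Q)
    (hQ : ¬ indepIn G Q) :
    (∃ w ∈ nbrs G {u, v}, {u, v, w} ⊆ Q) ∨
      ∃ e ∈ G.edgeFinset.filter (fun e => u ∉ e ∧ v ∉ e), {u, v} ∪ e.toFinset ⊆ Q := by
  have huv' : ¬ G.Adj v u := fun h => huv h.symm
  simp only [indepIn, not_forall, not_not] at hQ
  obtain ⟨a, ha, b, hb, hab⟩ := hQ
  have key : ∀ x y : V, G.Adj x y → y ∈ Q → x = u ∨ x = v →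
      ∃ w ∈ nbrs G {u, v}, {u, v, w} ⊆ Q := by
    intro x y hxy hy hx
    refine ⟨y, ?_, ?_⟩
    · simp only [nbrs, Finset.mem_filter, Finset.mem_univ, true_and, Finset.mem_insert,
        Finset.mem_singleton]
      refine ⟨?_, x, hx, hxy.symm⟩
      rintro (rfl | rfl) <;> rcases hx with rfl | rfl
      · exact G.loopless.irrefl _ hxy
      · exact huv' hxy
      · exact huv hxy
      · exact G.loopless.irrefl _ hxy
    · simp [Finset.insert_subset_iff, hu, hv, hy]
  by_cases h1 : a = u ∨ a = v
  · exact Or.inl (key a b hab hb h1)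
  by_cases h2 : b = u ∨ b = v
  · exact Or.inl (key b a hab.symm ha h2)
  push Not at h1 h2
  refine Or.inr ⟨s(a, b), ?_, ?_⟩
  · simp only [Finset.mem_filter, SimpleGraph.mem_edgeFinset, SimpleGraph.mem_edgeSet,
      Sym2.mem_iff]
    exact ⟨hab, by rintro (h | h) <;> simp_all, by rintro (h | h) <;> simp_all⟩
  · intro x hx
    simp only [Finset.mem_union, Finset.mem_insert, Finset.mem_singleton, Sym2.mem_toFinset,
      Sym2.mem_iff] at hx
    rcases hx with (rfl | rfl) | (rfl | rfl) <;> assumption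

/-- The probability that a random query does not discover the non-edge `{u,v}`. -/
theorem sum_qweight_not_discover_le {V : Type} [Fintype V] [DecidableEq V] (G : SimpleGraph V)
    [DecidableRel G.Adj] {p r : ℝ} (hp0 : 0 ≤ p) (hp1 : p ≤ 1) {u v : V} (hne : u ≠ v)
    (huv : ¬ G.Adj u v) (hd : ((nbrs G {u, v}).card : ℝ) ≤ r) :
    ∑ Q : Finset V, (if u ∈ Q ∧ v ∈ Q ∧ indepIn G Q then 0 else qweight p Q)
      ≤ 1 - p ^ 2 * (1 - r * p - G.edgeFinset.card * p ^ 2) := by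
  set N := nbrs G {u, v} with hN
  set E := G.edgeFinset.filter (fun e => u ∉ e ∧ v ∉ e) with hE
  let I : Finset V → Finset V → ℝ := fun S Q => if S ⊆ Q then qweight p Q else 0
  have hI0 : ∀ S Q, 0 ≤ I S Q := fun S Q => by
    simp only [I]; split_ifs
    exacts [qweight_nonneg hp0 hp1 Q, le_rfl]
  have hpt : ∀ Q : Finset V, (if u ∈ Q ∧ v ∈ Q ∧ indepIn G Q then 0 else qweight p Q)
      ≤ qweight p Q - I {u, v} Q + ∑ w ∈ N, I {u, v, w} Q
        + ∑ e ∈ E, I ({u, v} ∪ e.toFinset) Q := by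
    intro Q
    have hN0 : 0 ≤ ∑ w ∈ N, I {u, v, w} Q := Finset.sum_nonneg fun _ _ => hI0 _ _
    have hE0 : 0 ≤ ∑ e ∈ E, I ({u, v} ∪ e.toFinset) Q := Finset.sum_nonneg fun _ _ => hI0 _ _
    by_cases hS : u ∈ Q ∧ v ∈ Q
    · have hIS : I {u, v} Q = qweight p Q :=
        if_pos (by simp [Finset.insert_subset_iff, hS.1, hS.2])
      by_cases hQ : indepIn G Q
      · rw [if_pos ⟨hS.1, hS.2, hQ⟩, hIS]; linarith
      · rw [if_neg (fun h => hQ h.2.2), hIS]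
        rcases nbr_or_edge_of_not_indepIn G huv hS.1 hS.2 hQ with ⟨w, hw, hwQ⟩ | ⟨e, he, heQ⟩
        · have h1 := Finset.single_le_sum (f := fun w => I {u, v, w} Q)
            (fun _ _ => hI0 _ _) hw
          have h2 : I {u, v, w} Q = qweight p Q := if_pos hwQ
          simp only [h2] at h1
          linarith
        · have h1 := Finset.single_le_sum (f := fun e : Sym2 V => I ({u, v} ∪ e.toFinset) Q)
            (fun _ _ => hI0 _ _) he
          have h2 : I ({u, v} ∪ e.toFinset) Q = qweight p Q := if_pos heQ
          simp only [h2] at h1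
          linarith
    · have hIS : I {u, v} Q = 0 :=
        if_neg (fun h => hS (by simpa [Finset.insert_subset_iff] using h))
      rw [if_neg (fun h => hS ⟨h.1, h.2.1⟩), hIS]; linarith
  have hsum : ∀ S : Finset V, ∑ Q, I S Q = p ^ S.card := sum_qweight_superset p
  have hNs : ∀ w ∈ N, p ^ ({u, v, w} : Finset V).card = p ^ 3 := by
    intro w hw
    have : w ∉ ({u, v} : Finset V) := by
      simp only [hN, nbrs, Finset.mem_filter] at hw
      simpa using hw.2.1
    simp only [Finset.mem_insert, Finset.mem_singleton, not_or] at this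
    rw [Finset.card_eq_three.2 ⟨u, v, w, hne, Ne.symm this.1, Ne.symm this.2, rfl⟩]
  have hEs : ∀ e ∈ E, p ^ ({u, v} ∪ e.toFinset : Finset V).card = p ^ 4 := by
    intro e he
    rw [hE, Finset.mem_filter, SimpleGraph.mem_edgeFinset] at he
    rw [Finset.card_union_of_disjoint, Finset.card_pair hne,
      Sym2.card_toFinset_of_not_isDiag e (G.not_isDiag_of_mem_edgeSet he.1)]
    simp [he.2.1, he.2.2]
  have hNsum : ∑ Q, ∑ w ∈ N, I {u, v, w} Q = N.card * p ^ 3 := by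
    rw [Finset.sum_comm, ← nsmul_eq_mul, ← Finset.sum_const]
    exact Finset.sum_congr rfl fun w hw => (hsum _).trans (hNs w hw)
  have hEsum : ∑ Q, ∑ e ∈ E, I ({u, v} ∪ e.toFinset) Q = E.card * p ^ 4 := by
    rw [Finset.sum_comm, ← nsmul_eq_mul, ← Finset.sum_const]
    exact Finset.sum_congr rfl fun e he => (hsum _).trans (hEs e he)
  have hle := Finset.sum_le_sum fun Q (_ : Q ∈ Finset.univ) => hpt Q
  rw [Finset.sum_add_distrib, Finset.sum_add_distrib, Finset.sum_sub_distrib, sum_qweight,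
    hsum, hNsum, hEsum, Finset.card_pair hne] at hle
  have hEc : (E.card : ℝ) ≤ G.edgeFinset.card := by
    exact_mod_cast Finset.card_filter_le _ _
  have h3 := mul_le_mul_of_nonneg_right hd (pow_nonneg hp0 3)
  have h4 := mul_le_mul_of_nonneg_right hEc (pow_nonneg hp0 4)
  linear_combination hle + h3 + h4

theorem qprobT_forall {V : Type} [Fintype V] (p : ℝ) (t : ℕ) (B : Finset V → Prop)
    [DecidablePred B] :
    qprobT p t (fun Qs => ∀ i, ¬ B (Qs i))
      = (∑ Q : Finset V, if B Q then 0 else qweight p Q) ^ t := by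
  rw [Fintype.sum_pow, qprobT]
  refine Finset.sum_congr rfl fun Qs _ => ?_
  split_ifs with h
  · exact Finset.prod_congr rfl fun i _ => (if_neg (h i)).symm
  · push Not at h
    obtain ⟨i, hi⟩ := h
    symm
    refine Finset.prod_eq_zero (Finset.mem_univ i) ?_
    exact if_pos hi

theorem qprobT_survives_le {V : Type} [Fintype V] [DecidableEq V] (G : SimpleGraph V)
    [DecidableRel G.Adj] {p r : ℝ} (hp0 : 0 ≤ p) (hp1 : p ≤ 1) (t : ℕ) {u v : V} (hne : u ≠ v)
    (huv : ¬ G.Adj u v) (hd : ((nbrs G {u, v}).card : ℝ) ≤ r) :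
    qprobT p t (fun Qs => survives G Qs u v)
      ≤ (1 - p ^ 2 * (1 - r * p - G.edgeFinset.card * p ^ 2)) ^ t := by
  simp only [survives, not_exists]
  rw [qprobT_forall p t (fun Q => u ∈ Q ∧ v ∈ Q ∧ indepIn G Q)]
  refine pow_le_pow_left₀ (Finset.sum_nonneg fun Q _ => ?_)
    (sum_qweight_not_discover_le G hp0 hp1 hne huv hd) t
  split_ifs
  exacts [le_rfl, qweight_nonneg hp0 hp1 Q]

/-- Markov's inequality for a random variable that is at least one on the event. -/
theorem qprobT_le_qexpT {V : Type} [Fintype V] {p : ℝ} (hp0 : 0 ≤ p) (hp1 : p ≤ 1) (t : ℕ)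
    (A : (Fin t → Finset V) → Prop) (f : (Fin t → Finset V) → ℝ) (hf0 : ∀ Qs, 0 ≤ f Qs)
    (hf : ∀ Qs, A Qs → 1 ≤ f Qs) : qprobT p t A ≤ qexpT p t f := by
  refine Finset.sum_le_sum fun Qs _ => ?_
  have h0 : 0 ≤ ∏ i, qweight p (Qs i) := Finset.prod_nonneg fun _ _ => qweight_nonneg hp0 hp1 _
  split_ifs with h
  · exact le_mul_of_one_le_right h0 (hf Qs h)
  · exact mul_nonneg h0 (hf0 Qs)

/-- The expected number of surviving non-edges with few neighbours. -/
theorem qexpT_card_survivors_le {V : Type} [Fintype V] [DecidableEq V] (G : SimpleGraph V)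
    [DecidableRel G.Adj] {p r : ℝ} (hp0 : 0 ≤ p) (hp1 : p ≤ 1) (t : ℕ)
    (hq : 0 ≤ 1 - p ^ 2 * (1 - r * p - G.edgeFinset.card * p ^ 2)) :
    qexpT p t (fun Qs =>
        (((Finset.univ : Finset (Finset V)).filter fun s =>
            ∃ u v : V, u ≠ v ∧ s = {u, v} ∧ ¬ G.Adj u v ∧
              ((nbrs G {u, v}).card : ℝ) ≤ r ∧ survives G Qs u v).card : ℝ))
      ≤ (Fintype.card V : ℝ) ^ 2 *
        (1 - p ^ 2 * (1 - r * p - G.edgeFinset.card * p ^ 2)) ^ t := by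
  let P : V × V → Prop := fun x => x.1 ≠ x.2 ∧ ¬ G.Adj x.1 x.2 ∧
    ((nbrs G {x.1, x.2}).card : ℝ) ≤ r
  calc _ ≤ ∑ Qs : Fin t → Finset V, (∏ i, qweight p (Qs i)) *
            ∑ x : V × V, if P x ∧ survives G Qs x.1 x.2 then (1 : ℝ) else 0 := by
        refine Finset.sum_le_sum fun Qs _ => mul_le_mul_of_nonneg_left ?_
          (Finset.prod_nonneg fun _ _ => qweight_nonneg hp0 hp1 _)
        rw [Finset.sum_boole]
        refine Nat.cast_le.2 ((Finset.card_le_card ?_).trans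
          (Finset.card_image_le (f := fun x : V × V => ({x.1, x.2} : Finset V))))
        intro s hs
        obtain ⟨u, v, h1, h2, h3, h4, h5⟩ := (Finset.mem_filter.1 hs).2
        exact Finset.mem_image.2
          ⟨(u, v), Finset.mem_filter.2 ⟨Finset.mem_univ _, ⟨h1, h3, h4⟩, h5⟩, h2.symm⟩
    _ = ∑ x : V × V, ∑ Qs : Fin t → Finset V,
          if P x ∧ survives G Qs x.1 x.2 then ∏ i, qweight p (Qs i) else 0 := by
        rw [Finset.sum_comm]
        simp only [Finset.mul_sum, mul_ite, mul_one, mul_zero]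
    _ ≤ ∑ _x : V × V, (1 - p ^ 2 * (1 - r * p - G.edgeFinset.card * p ^ 2)) ^ t := by
        refine Finset.sum_le_sum fun x _ => ?_
        by_cases hx : P x
        · simp only [hx, true_and]
          exact qprobT_survives_le G hp0 hp1 t hx.1 hx.2.1 hx.2.2
        · simp only [hx, false_and, if_false, Finset.sum_const_zero]
          exact pow_nonneg hq t
    _ = _ := by
        simp [sq]

theorem sq_mul_one_sub_pow_le {n t : ℕ} {q δ : ℝ} (hn : 0 < n) (hδ : 0 < δ) (hq0 : 0 < q)
    (hq1 : q ≤ 1) (ht : (2 * Real.log n + Real.log (1 / δ)) / q ≤ t) :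
    (n : ℝ) ^ 2 * (1 - q) ^ t ≤ δ := by
  have hn' : (0 : ℝ) < n := Nat.cast_pos.2 hn
  rw [div_le_iff₀ hq0, one_div, Real.log_inv] at ht
  calc (n : ℝ) ^ 2 * (1 - q) ^ t ≤ (n : ℝ) ^ 2 * Real.exp (-q) ^ t := by
        have := pow_le_pow_left₀ (sub_nonneg.2 hq1) (Real.one_sub_le_exp_neg q) t
        gcongr
    _ = Real.exp (2 * Real.log n + t * (-q)) := by
        rw [Real.exp_add, Real.exp_nat_mul, two_mul, Real.exp_add, Real.exp_log hn', sq]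
    _ ≤ Real.exp (Real.log δ) := Real.exp_le_exp.2 (by linarith)
    _ = δ := Real.exp_log hδ

theorem stmt1 {V : Type} [Fintype V] [DecidableEq V]
    (G : SimpleGraph V) [DecidableRel G.Adj]
    (n m : ℕ) (hn : Fintype.card V = n) (hn2 : 2 ≤ n)
    (hm : G.edgeFinset.card = m)
    (p r δ : ℝ) (hp0 : 0 ≤ p) (hp1 : p ≤ 1) (hr : 0 ≤ r)
    (hδ0 : 0 < δ) (hδ1 : δ < 1)
    (hpos : 0 < p ^ 2 * (1 - r * p - m * p ^ 2))
    (t : ℕ)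
    (ht : (2 * Real.log n + Real.log (1 / δ)) / (p ^ 2 * (1 - r * p - m * p ^ 2)) ≤ t) :
    (qprobT p t (fun Qs => ∃ u v : V, u ≠ v ∧ ¬ G.Adj u v ∧
          ((nbrs G {u, v}).card : ℝ) ≤ r ∧ survives G Qs u v)
        ≤ (n : ℝ) ^ 2 * (1 - p ^ 2 * (1 - r * p - m * p ^ 2)) ^ t
      ∧ (n : ℝ) ^ 2 * (1 - p ^ 2 * (1 - r * p - m * p ^ 2)) ^ t ≤ δ)
    ∧ qexpT p t (fun Qs =>
        (((Finset.univ : Finset (Finset V)).filter fun s =>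
            ∃ u v : V, u ≠ v ∧ s = {u, v} ∧ ¬ G.Adj u v ∧
              ((nbrs G {u, v}).card : ℝ) ≤ r ∧ survives G Qs u v).card : ℝ)) ≤ δ := by
  subst hn hm
  have hq1 : p ^ 2 * (1 - r * p - G.edgeFinset.card * p ^ 2) ≤ 1 := by
    have h1 : p ^ 2 ≤ 1 := pow_le_one₀ hp0 hp1
    have h2 : 0 ≤ r * p := mul_nonneg hr hp0
    have h3 : (0 : ℝ) ≤ G.edgeFinset.card * p ^ 2 := by positivity
    nlinarith [mul_nonneg (sq_nonneg p) (add_nonneg h2 h3)]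
  have hexp := qexpT_card_survivors_le G (r := r) hp0 hp1 t (sub_nonneg.2 hq1)
  have hδ := sq_mul_one_sub_pow_le (by omega) hδ0 hpos hq1 ht
  refine ⟨⟨(qprobT_le_qexpT hp0 hp1 t _ _ (fun _ => Nat.cast_nonneg _) ?_).trans hexp, hδ⟩,
    hexp.trans hδ⟩
  rintro Qs ⟨u, v, h1, h2, h3, h4⟩
  exact Nat.one_le_cast.2 (Finset.card_pos.2
    ⟨{u, v}, Finset.mem_filter.2 ⟨Finset.mem_univ _, u, v, h1, rfl, h2, h3, h4⟩⟩)
end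

section
/- Let G = (V,E) be a simple graph with n vertices and at most m edges, where m ≥ 2, let I ⊆ V be an independent set of G and let v ∈ V∖I. Set p = 1/m, let δ ∈ (0,1), and let t be an integer with t ≥ 4m(ln n + ln(1/δ)). Let Q_1, …, Q_t be independent random subsets of I, each vertex of I being included in each Q_i independently with probability p. Say that u ∈ I survives if for every i ∈ [t], either u ∉ Q_i or Q_i ∩ Γ_G(v) ≠ ∅. Then with probability at least 1 − δ, the set of surviving vertices of I is exactly Γ_G(v) ∩ I. -/
open Finset
open scoped Classical

/-- The probability that a random subset of `I` (each vertex of `I` included independently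
with probability `p`) equals the given finite set `Q`. -/
noncomputable def qweightIn {V : Type} [Fintype V] [DecidableEq V]
    (I : Finset V) (p : ℝ) (Q : Finset V) : ℝ :=
  if Q ⊆ I then p ^ Q.card * (1 - p) ^ (I.card - Q.card) else 0

/-- The probability that `t` independent random subsets of `I` (each vertex of `I` included
independently with probability `p`) satisfy the event `A`. -/
noncomputable def qprobTIn {V : Type} [Fintype V] [DecidableEq V]
    (I : Finset V) (p : ℝ) (t : ℕ) (A : (Fin t → Finset V) → Prop) : ℝ :=
  ∑ Qs : Fin t → Finset V, if A Qs then ∏ i, qweightIn I p (Qs i) else 0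

theorem qweightIn_nonneg {V : Type} [Fintype V] [DecidableEq V] (I : Finset V) {p : ℝ}
    (hp0 : 0 ≤ p) (hp1 : p ≤ 1) (Q : Finset V) : 0 ≤ qweightIn I p Q := by
  unfold qweightIn
  have : 0 ≤ 1 - p := by linarith
  split_ifs <;> positivity

theorem sum_qweightIn {V : Type} [Fintype V] [DecidableEq V] (I : Finset V) (p : ℝ) :
    ∑ Q, qweightIn I p Q = 1 := by
  have h := Finset.sum_pow_mul_eq_add_pow p (1 - p) I
  rw [add_sub_cancel, one_pow] at h
  rw [← h]
  simp only [qweightIn]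
  rw [← Finset.sum_filter]
  refine Finset.sum_congr ?_ fun _ _ => rfl
  ext Q
  simp

/-- The probability that a random subset of `I` contains `u` and avoids `N` is at least
`p (1 - p) ^ |N ∩ I|` (in fact equal to it). -/
theorem le_sum_qweightIn_mem_disjoint {V : Type} [Fintype V] [DecidableEq V] (I N : Finset V)
    {p : ℝ} (hp0 : 0 ≤ p) (hp1 : p ≤ 1) {u : V} (hu : u ∈ I) (huN : u ∉ N) :
    p * (1 - p) ^ (N ∩ I).card ≤
      ∑ Q, if u ∈ Q ∧ Disjoint Q N then qweightIn I p Q else 0 := by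
  set J := (I \ N).erase u with hJ
  have huJ : u ∉ J := Finset.notMem_erase u _
  have hcard : I.card = J.card + 1 + (N ∩ I).card := by
    have h1 : J.card + 1 = (I \ N).card :=
      Finset.card_erase_add_one (Finset.mem_sdiff.2 ⟨hu, huN⟩)
    rw [h1, Finset.inter_comm, Finset.card_sdiff_add_card_inter]
  have hsum := Finset.sum_pow_mul_eq_add_pow p (1 - p) J
  rw [add_sub_cancel, one_pow] at hsum
  have hinj : Set.InjOn (insert u) (J.powerset : Set (Finset V)) := by
    intro R hR S hS h
    have hR' : u ∉ R := fun h => huJ (Finset.mem_powerset.1 hR h)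
    have hS' : u ∉ S := fun h => huJ (Finset.mem_powerset.1 hS h)
    rw [← Finset.erase_insert hR', ← Finset.erase_insert hS', h]
  calc p * (1 - p) ^ (N ∩ I).card
      = ∑ R ∈ J.powerset,
          p * (1 - p) ^ (N ∩ I).card * (p ^ R.card * (1 - p) ^ (J.card - R.card)) := by
        rw [← Finset.mul_sum, hsum, mul_one]
    _ = ∑ R ∈ J.powerset, (fun Q => if u ∈ Q ∧ Disjoint Q N then qweightIn I p Q else 0)
          (insert u R) := by
        refine Finset.sum_congr rfl fun R hR => ?_
        have hRJ := Finset.mem_powerset.1 hR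
        have huR : u ∉ R := fun h => huJ (hRJ h)
        have hRI : R ⊆ I \ N := hRJ.trans (Finset.erase_subset _ _)
        have hsub : insert u R ⊆ I :=
          Finset.insert_subset hu (hRI.trans Finset.sdiff_subset)
        have hdis : Disjoint (insert u R) N :=
          Finset.disjoint_insert_left.2 ⟨huN, Finset.disjoint_of_subset_left hRI
            Finset.sdiff_disjoint⟩
        have hle := Finset.card_le_card hRJ
        have hexp : I.card - (R.card + 1) = (N ∩ I).card + (J.card - R.card) := by omega
        simp only [qweightIn, Finset.mem_insert_self, hdis, hsub, and_self, if_true,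
          Finset.card_insert_of_notMem huR, hexp]
        ring
    _ = ∑ Q ∈ J.powerset.image (insert u),
          if u ∈ Q ∧ Disjoint Q N then qweightIn I p Q else 0 := by
        rw [Finset.sum_image hinj]
    _ ≤ _ := by
        refine Finset.sum_le_sum_of_subset_of_nonneg (Finset.subset_univ _) fun Q _ _ => ?_
        split_ifs
        exacts [qweightIn_nonneg I hp0 hp1 Q, le_rfl]

/-- Independence: an event required of every one of the `t` subsets has the `t`-th power of its
probability. -/
theorem qprobTIn_forall {V : Type} [Fintype V] [DecidableEq V] (I : Finset V) (p : ℝ) (t : ℕ)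
    (B : Finset V → Prop) [DecidablePred B] :
    qprobTIn I p t (fun Qs => ∀ i, B (Qs i)) =
      (∑ Q, if B Q then qweightIn I p Q else 0) ^ t := by
  rw [Fintype.sum_pow]
  refine Finset.sum_congr rfl fun Qs _ => ?_
  rw [Finset.prod_ite_zero]
  simp

/-- Union bound: if `A` fails only when some `B u` with `u ∈ S` holds, then the probability of
`A` is at least one minus the sum of the probabilities of the `B u`. -/
theorem one_sub_sum_qprobTIn_le {V ι : Type} [Fintype V] [DecidableEq V] (I : Finset V) {p : ℝ}
    (hp0 : 0 ≤ p) (hp1 : p ≤ 1) (t : ℕ) (A : (Fin t → Finset V) → Prop) (S : Finset ι)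
    (B : ι → (Fin t → Finset V) → Prop) (h : ∀ Qs, ¬ A Qs → ∃ u ∈ S, B u Qs) :
    1 - ∑ u ∈ S, qprobTIn I p t (B u) ≤ qprobTIn I p t A := by
  have htot : ∑ Qs : Fin t → Finset V, ∏ i, qweightIn I p (Qs i) = 1 := by
    rw [← Fintype.sum_pow, sum_qweightIn, one_pow]
  rw [sub_le_iff_le_add, ← htot]
  simp only [qprobTIn]
  rw [Finset.sum_comm, ← Finset.sum_add_distrib]
  refine Finset.sum_le_sum fun Qs _ => ?_
  have hw : 0 ≤ ∏ i, qweightIn I p (Qs i) :=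
    Finset.prod_nonneg fun i _ => qweightIn_nonneg I hp0 hp1 _
  have hterm : ∀ u ∈ S, 0 ≤ if B u Qs then ∏ i, qweightIn I p (Qs i) else 0 := by
    intro u _
    split_ifs
    exacts [hw, le_rfl]
  by_cases hA : A Qs
  · rw [if_pos hA]
    exact le_add_of_nonneg_right (Finset.sum_nonneg hterm)
  · obtain ⟨u, hu, hB⟩ := h Qs hA
    rw [if_neg hA, zero_add]
    simpa only [if_pos hB] using Finset.single_le_sum hterm hu

theorem one_fourth_le_one_sub_inv_pow {m : ℕ} (hm : 2 ≤ m) :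
    (1 / 4 : ℝ) ≤ (1 - 1 / m) ^ m := by
  have hm' : (2 : ℝ) ≤ m := by exact_mod_cast hm
  have hm0 : (0 : ℝ) < m := by linarith
  have hinv : 1 / (m : ℝ) ≤ 1 := by rw [div_le_one hm0]; linarith
  have hbern := one_add_mul_self_le_rpow_one_add (s := -(1 / (m : ℝ))) (p := (m : ℝ) / 2)
    (by linarith) (by linarith)
  have hhalf : 1 + (m : ℝ) / 2 * -(1 / (m : ℝ)) = 1 / 2 := by
    field_simp
    norm_num
  rw [hhalf, ← sub_eq_add_neg] at hbern
  calc (1 / 4 : ℝ) = (1 / 2) ^ 2 := by norm_num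
    _ ≤ ((1 - 1 / (m : ℝ)) ^ ((m : ℝ) / 2)) ^ 2 := by gcongr
    _ = (1 - 1 / m) ^ m := by
      rw [← Real.rpow_mul_natCast (by linarith), ← Real.rpow_natCast]
      congr 1
      push_cast
      ring

theorem one_sub_pow_le_div {m n t : ℕ} (hm : 0 < m) (hn : 0 < n) {δ : ℝ} (hδ : 0 < δ)
    (ht : 4 * (m : ℝ) * (Real.log n + Real.log (1 / δ)) ≤ t) :
    (1 - 1 / (4 * (m : ℝ))) ^ t ≤ δ / n := by
  have hm1 : (1 : ℝ) ≤ m := by exact_mod_cast hm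
  have hn0 : (0 : ℝ) < n := by exact_mod_cast hn
  have hinv : 1 / (4 * (m : ℝ)) ≤ 1 := by
    rw [div_le_one (by linarith)]
    linarith
  calc (1 - 1 / (4 * (m : ℝ))) ^ t ≤ Real.exp (-(1 / (4 * (m : ℝ)))) ^ t :=
        pow_le_pow_left₀ (by linarith) (Real.one_sub_le_exp_neg _) t
    _ = Real.exp (-(t / (4 * (m : ℝ)))) := by
        rw [← Real.exp_nat_mul]
        congr 1
        ring
    _ ≤ Real.exp (Real.log (δ / n)) := by
        apply Real.exp_le_exp.2
        rw [Real.log_div hδ.ne' hn0.ne']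
        rw [one_div, Real.log_inv] at ht
        have : Real.log n + -Real.log δ ≤ t / (4 * (m : ℝ)) := by
          rw [le_div_iff₀ (by linarith)]
          linarith
        linarith
    _ = δ / n := Real.exp_log (by positivity)

theorem stmt2 {V : Type} [Fintype V] [DecidableEq V]
    (G : SimpleGraph V) [DecidableRel G.Adj]
    (n m : ℕ) (hn : Fintype.card V = n) (hm2 : 2 ≤ m)
    (hm : G.edgeFinset.card ≤ m)
    (I : Finset V) (hI : indepIn G I) (v : V) (hv : v ∉ I)
    (δ : ℝ) (hδ0 : 0 < δ) (hδ1 : δ < 1)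
    (t : ℕ) (ht : 4 * (m : ℝ) * (Real.log n + Real.log (1 / δ)) ≤ t) :
    1 - δ ≤ qprobTIn I (1 / m) t (fun Qs =>
      (I.filter fun u => ∀ i, u ∉ Qs i ∨ (Qs i ∩ G.neighborFinset v).Nonempty)
        = G.neighborFinset v ∩ I) := by
  have hm' : (2 : ℝ) ≤ m := by exact_mod_cast hm2
  have hm0 : (0 : ℝ) < m := by linarith
  have hp0 : 0 ≤ 1 / (m : ℝ) := by positivity
  have hp1 : 1 / (m : ℝ) ≤ 1 := by
    rw [div_le_one hm0]
    linarith
  have hn0 : 0 < n := hn ▸ Fintype.card_pos_iff.2 ⟨v⟩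
  have hnR : (0 : ℝ) < n := by exact_mod_cast hn0
  set N := G.neighborFinset v with hN
  have hd : (N ∩ I).card ≤ m := by
    refine (Finset.card_le_card Finset.inter_subset_left).trans (le_trans ?_ hm)
    rw [hN, G.card_neighborFinset_eq_degree, ← G.card_incidenceFinset_eq_degree]
    exact Finset.card_le_card (G.incidenceFinset_subset v)
  have hsurv : ∀ u ∈ I \ N, qprobTIn I (1 / m) t
      (fun Qs => ∀ i, ¬ (u ∈ Qs i ∧ Disjoint (Qs i) N)) ≤ δ / n := by
    intro u hu
    obtain ⟨huI, huN⟩ := Finset.mem_sdiff.1 hu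
    rw [qprobTIn_forall I (1 / m) t fun Q => ¬ (u ∈ Q ∧ Disjoint Q N)]
    refine le_trans (pow_le_pow_left₀ ?_ ?_ t) (one_sub_pow_le_div (by omega) hn0 hδ0 ht)
    · refine Finset.sum_nonneg fun Q _ => ?_
      split_ifs
      exacts [le_rfl, qweightIn_nonneg I hp0 hp1 Q]
    · have hle := le_sum_qweightIn_mem_disjoint I N hp0 hp1 huI huN
      have hpow : (1 / 4 : ℝ) ≤ (1 - 1 / m) ^ (N ∩ I).card :=
        (one_fourth_le_one_sub_inv_pow hm2).trans
          (pow_le_pow_of_le_one (by linarith) (by linarith) hd)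
      have hquarter : 1 / (4 * (m : ℝ)) ≤ 1 / m * (1 - 1 / m) ^ (N ∩ I).card := by
        calc 1 / (4 * (m : ℝ)) = 1 / m * (1 / 4) := by ring
          _ ≤ _ := by gcongr
      have hsplit : (∑ Q, if ¬ (u ∈ Q ∧ Disjoint Q N) then qweightIn I (1 / m) Q else 0) +
          (∑ Q, if u ∈ Q ∧ Disjoint Q N then qweightIn I (1 / m) Q else 0) = 1 := by
        rw [← Finset.sum_add_distrib]
        refine (Finset.sum_congr rfl fun Q _ => ?_).trans (sum_qweightIn I (1 / (m : ℝ)))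
        by_cases hQ : u ∈ Q ∧ Disjoint Q N
        · rw [if_pos hQ, if_neg (not_not.2 hQ), zero_add]
        · rw [if_neg hQ, if_pos hQ, add_zero]
      linarith
  have hunion : ∑ u ∈ I \ N, qprobTIn I (1 / m) t
      (fun Qs => ∀ i, ¬ (u ∈ Qs i ∧ Disjoint (Qs i) N)) ≤ δ := by
    have hc : ((I \ N).card : ℝ) ≤ n := by
      exact_mod_cast hn ▸ Finset.card_le_univ (I \ N)
    calc _ ≤ (I \ N).card • (δ / n) := Finset.sum_le_card_nsmul _ _ _ hsurv
      _ = (I \ N).card * (δ / n) := nsmul_eq_mul _ _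
      _ ≤ n * (δ / n) := by gcongr
      _ = δ := by field_simp
  refine le_trans (sub_le_sub_left hunion 1)
    (one_sub_sum_qprobTIn_le I hp0 hp1 t _ (I \ N) _ fun Qs hA => ?_)
  by_contra! hno
  refine hA (Finset.ext fun u => ?_)
  rw [Finset.mem_filter, Finset.mem_inter]
  constructor
  · rintro ⟨huI, hu⟩
    refine ⟨by_contra fun huN => ?_, huI⟩
    obtain ⟨i, hi, hdis⟩ := hno u (Finset.mem_sdiff.2 ⟨huI, huN⟩)
    rcases hu i with h | h
    · exact h hi
    · exact Finset.not_disjoint_iff_nonempty_inter.2 h hdis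
  · rintro ⟨huN, huI⟩
    refine ⟨huI, fun i => ?_⟩
    by_cases hi : u ∈ Qs i
    · exact Or.inr ⟨u, Finset.mem_inter.2 ⟨hi, huN⟩⟩
    · exact Or.inl hi
end

section
/- Let V be a finite set, let e_1, …, e_t (t ≥ 1) be distinct two-element subsets of V, let 0 ≤ p ≤ 1, and let Q be a p-random query. Then the probability that e_i ⊆ Q for some i ∈ [t] is at least p·(1 − (1 − p)^t). -/
open Finset
open scoped Classical

/-- The total weight of the subsets of `S` that avoid a subset `N` of `S`. -/
theorem sum_weight_disjoint {V : Type} [DecidableEq V] (p : ℝ) {S N : Finset V} (hN : N ⊆ S) :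
    ∑ Q ∈ S.powerset with Disjoint N Q, p ^ #Q * (1 - p) ^ (#S - #Q) = (1 - p) ^ #N := by
  have hset : S.powerset.filter (fun Q => Disjoint N Q) = (S \ N).powerset := by
    ext Q
    simp only [mem_filter, mem_powerset, subset_sdiff, disjoint_comm]
  have hc : #(S \ N) + #N = #S := card_sdiff_add_card_eq_card hN
  rw [hset]
  calc ∑ Q ∈ (S \ N).powerset, p ^ #Q * (1 - p) ^ (#S - #Q)
      = ∑ Q ∈ (S \ N).powerset, p ^ #Q * (1 - p) ^ (#(S \ N) - #Q) * (1 - p) ^ #N := by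
        refine sum_congr rfl fun Q hQ => ?_
        have hQc := card_le_card (mem_powerset.1 hQ)
        rw [mul_assoc, ← pow_add]
        congr 2
        omega
    _ = (1 - p) ^ #N := by
        rw [← sum_mul, sum_pow_mul_eq_add_pow]
        simp

/-- The number of edges at `v` equals the number of neighbours of `v`. -/
theorem card_edges_at {V : Type} [DecidableEq V] {S : Finset V} {v : V} (hv : v ∉ S)
    {E : Finset (Finset V)} (hE : ∀ x ∈ E, #x = 2 ∧ x ⊆ insert v S) :
    #{x ∈ E | v ∈ x} = #{u ∈ S | ({v, u} : Finset V) ∈ E} := by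
  symm
  refine card_bij (fun u _ => {v, u}) ?_ ?_ ?_
  · intro u hu
    simp [(mem_filter.1 hu).2]
  · intro a ha b hb hab
    have hav : a ≠ v := fun h => hv (h ▸ (mem_filter.1 ha).1)
    have : a ∈ ({v, b} : Finset V) := hab ▸ (by simp)
    simpa [hav] using this
  · intro x hx
    obtain ⟨hxE, hvx⟩ := mem_filter.1 hx
    obtain ⟨hx2, hxS⟩ := hE x hxE
    obtain ⟨u, hu⟩ := card_eq_one.1 (show #(x.erase v) = 1 by rw [card_erase_of_mem hvx, hx2])
    have hxu : ({v, u} : Finset V) = x := by rw [← insert_erase hvx, hu]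
    have hux : u ∈ x.erase v := by simp [hu]
    refine ⟨u, mem_filter.2 ⟨?_, hxu ▸ hxE⟩, hxu⟩
    exact mem_of_mem_insert_of_ne (hxS (mem_of_mem_erase hux)) (ne_of_mem_erase hux)

/-- The probability that a `p`-random subset of `S` contains none of the edges in `E`
is at most `(1 - p) + p * (1 - p) ^ #E`. -/
theorem sum_weight_independent_le {V : Type} [DecidableEq V] (p : ℝ) (hp0 : 0 ≤ p) (hp1 : p ≤ 1)
    (S : Finset V) (E : Finset (Finset V)) (hE : ∀ x ∈ E, #x = 2 ∧ x ⊆ S) :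
    ∑ Q ∈ S.powerset, (if ∀ x ∈ E, ¬ x ⊆ Q then p ^ #Q * (1 - p) ^ (#S - #Q) else 0) ≤
      (1 - p) + p * (1 - p) ^ #E := by
  have hq0 : 0 ≤ 1 - p := by linarith
  have hq1 : 1 - p ≤ 1 := by linarith
  induction S using Finset.induction_on generalizing E with
  | empty =>
    have hE0 : E = ∅ := by
      refine eq_empty_of_forall_notMem fun x hx => ?_
      obtain ⟨h2, hs⟩ := hE x hx
      simp [subset_empty.1 hs] at h2
    simp [hE0]
  | insert v S hv ih =>
    set E₀ := E.filter (fun x => v ∉ x) with hE₀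
    set N := S.filter (fun u => ({v, u} : Finset V) ∈ E) with hN
    have hcard : #N + #E₀ = #E := by
      rw [hN, ← card_edges_at hv hE, hE₀, card_filter_add_card_filter_not]
    have hind := ih E₀ fun x hx => by
      obtain ⟨hxE, hvx⟩ := mem_filter.1 hx
      exact ⟨(hE x hxE).1, (subset_insert_iff_of_notMem hvx).1 (hE x hxE).2⟩
    have hw0 : ∀ Q : Finset V, 0 ≤ p ^ #Q * (1 - p) ^ (#S - #Q) := fun Q => by positivity
    have h₁ : ∑ Q ∈ S.powerset,
        (if ∀ x ∈ E, ¬ x ⊆ Q then p ^ #Q * (1 - p) ^ (#(insert v S) - #Q) else 0) =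
        (1 - p) * ∑ Q ∈ S.powerset,
          (if ∀ x ∈ E₀, ¬ x ⊆ Q then p ^ #Q * (1 - p) ^ (#S - #Q) else 0) := by
      rw [mul_sum]
      refine sum_congr rfl fun Q hQ => ?_
      have hQS := mem_powerset.1 hQ
      have hiff : (∀ x ∈ E, ¬ x ⊆ Q) ↔ ∀ x ∈ E₀, ¬ x ⊆ Q :=
        ⟨fun h x hx => h x (mem_filter.1 hx).1, fun h x hx hxQ =>
          h x (mem_filter.2 ⟨hx, fun hvx => hv (hQS (hxQ hvx))⟩) hxQ⟩
      have hQc := card_le_card hQS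
      rw [card_insert_of_notMem hv, show #S + 1 - #Q = (#S - #Q) + 1 by omega, pow_succ]
      simp only [hiff]
      split_ifs <;> ring
    have hsplit : ∀ Q ∈ S.powerset, p ^ #(insert v Q) * (1 - p) ^ (#(insert v S) - #(insert v Q)) =
        p * (p ^ #Q * (1 - p) ^ (#S - #Q)) := fun Q hQ => by
      rw [card_insert_of_notMem hv, card_insert_of_notMem fun h => hv (mem_powerset.1 hQ h),
        Nat.add_sub_add_right, pow_succ]
      ring
    have h₂ : ∑ Q ∈ S.powerset, (if ∀ x ∈ E, ¬ x ⊆ insert v Q then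
        p ^ #(insert v Q) * (1 - p) ^ (#(insert v S) - #(insert v Q)) else 0) ≤
        p * (1 - p) ^ #N := by
      rw [← sum_weight_disjoint p (filter_subset _ S : N ⊆ S), sum_filter, mul_sum]
      refine sum_le_sum fun Q hQ => ?_
      rw [hsplit Q hQ]
      have hw := mul_nonneg hp0 (hw0 Q)
      by_cases h : ∀ x ∈ E, ¬ x ⊆ insert v Q
      · have hd : Disjoint N Q := disjoint_left.2 fun u hu huQ =>
          h _ (mem_filter.1 hu).2 (insert_subset_insert v (singleton_subset_iff.2 huQ))
        rw [if_pos h, if_pos hd]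
      · rw [if_neg h]
        split_ifs
        · exact hw
        · simp
    rw [sum_powerset_insert hv, h₁]
    rcases Nat.eq_zero_or_pos #N with hd | hd
    · have hEE : E₀ = E := eq_of_subset_of_card_le (filter_subset _ _) (by omega)
      have h₃ : ∑ Q ∈ S.powerset, (if ∀ x ∈ E, ¬ x ⊆ insert v Q then
          p ^ #(insert v Q) * (1 - p) ^ (#(insert v S) - #(insert v Q)) else 0) ≤
          p * ∑ Q ∈ S.powerset,
            (if ∀ x ∈ E₀, ¬ x ⊆ Q then p ^ #Q * (1 - p) ^ (#S - #Q) else 0) := by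
        rw [mul_sum]
        refine sum_le_sum fun Q hQ => ?_
        rw [hsplit Q hQ]
        have hw := mul_nonneg hp0 (hw0 Q)
        by_cases h : ∀ x ∈ E, ¬ x ⊆ insert v Q
        · rw [if_pos h, if_pos fun x hx hxQ =>
            h x (mem_filter.1 hx).1 (hxQ.trans (subset_insert v Q))]
        · rw [if_neg h]
          split_ifs
          · exact hw
          · simp
      rw [hEE] at hind h₃ ⊢
      linarith
    · have hd1 : (1 - p) ^ #N ≤ 1 - p := pow_le_of_le_one hq0 hq1 hd.ne'
      have ha1 : (1 - p) ^ #E₀ ≤ 1 := pow_le_one₀ hq0 hq1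
      have hprod : 0 ≤ p * ((1 - p - (1 - p) ^ #N) * (1 - (1 - p) ^ #E₀)) :=
        mul_nonneg hp0 (mul_nonneg (by linarith) (by linarith))
      have hmul := mul_le_mul_of_nonneg_left hind hq0
      rw [← hcard, pow_add]
      linarith

theorem stmt8 {V : Type} [Fintype V] [DecidableEq V]
    (t : ℕ) (ht : 1 ≤ t) (e : Fin t → Finset V)
    (hcard : ∀ i, (e i).card = 2) (hinj : Function.Injective e)
    (p : ℝ) (hp0 : 0 ≤ p) (hp1 : p ≤ 1) :
    p * (1 - (1 - p) ^ t) ≤ qprob p (fun Q => ∃ i, e i ⊆ Q) := by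
  have hind := sum_weight_independent_le p hp0 hp1 univ (univ.image e) fun x hx => by
    obtain ⟨i, -, rfl⟩ := mem_image.1 hx
    exact ⟨hcard i, subset_univ _⟩
  rw [card_image_of_injective _ hinj, card_fin, card_univ, powerset_univ] at hind
  have htotal : ∑ Q : Finset V, p ^ #Q * (1 - p) ^ (#(univ : Finset V) - #Q) = 1 := by
    rw [← powerset_univ, sum_pow_mul_eq_add_pow]
    simp
  have hcompl : qprob p (fun Q => ∃ i, e i ⊆ Q) + ∑ Q : Finset V,
      (if ∀ x ∈ univ.image e, ¬ x ⊆ Q then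
        p ^ #Q * (1 - p) ^ (#(univ : Finset V) - #Q) else 0) = 1 := by
    refine Eq.trans ?_ htotal
    rw [qprob, ← sum_add_distrib]
    refine sum_congr rfl fun Q _ => ?_
    by_cases h : ∃ i, e i ⊆ Q
    · have h' : ¬ ∀ x ∈ univ.image e, ¬ x ⊆ Q := fun hn =>
        h.elim fun i hi => hn _ (mem_image_of_mem e (mem_univ i)) hi
      rw [if_pos h, if_neg h', add_zero, qweight, card_univ]
    · have h' : ∀ x ∈ univ.image e, ¬ x ⊆ Q := fun x hx hxQ => by
        obtain ⟨i, -, rfl⟩ := mem_image.1 hx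
        exact h ⟨i, hxQ⟩
      rw [if_neg h, if_pos h', zero_add]
  rw [card_univ] at hcompl
  have hle : 1 - qprob p (fun Q => ∃ i, e i ⊆ Q) ≤ 1 - p + p * (1 - p) ^ t := by
    refine (sub_eq_of_eq_add' hcompl.symm).trans_le ?_
    convert hind
  linarith
end

section
/- Let G = (V,E) be a simple graph with m edges, let e'_1, …, e'_t be distinct two-element subsets of V none of which is an edge of G, let 0 < p < 1, let Q be a p-random query, and suppose the probability that e'_i ⊆ Q for some i ∈ [t] is at least q. Then the probability that simultaneously some e'_i ⊆ Q and Q is independent in G is at least q(1 − p)^m; in particular, it is at least p·(1 − (1 − p)^t)·(1 − p)^m. -/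
open Finset
open scoped Classical

theorem qweight_insert {V : Type} [Fintype V] (p : ℝ) {x : V} {Q : Finset V} (hx : x ∉ Q) :
    (1 - p) * qweight p (insert x Q) = p * qweight p Q := by
  have hlt : Q.card < Fintype.card V := card_lt_univ_of_notMem hx
  obtain ⟨k, hk⟩ := Nat.exists_eq_add_of_lt hlt
  have h1 : Fintype.card V - (Q.card + 1) = k := by omega
  have h2 : Fintype.card V - Q.card = k + 1 := by omega
  rw [qweight, qweight, card_insert_of_notMem hx, h1, h2]
  ring

theorem sum_finset_eq_sum_powerset_erase {V : Type} [Fintype V] (x : V) (g : Finset V → ℝ) :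
    ∑ Q, g Q = ∑ Q ∈ (univ.erase x).powerset, (g Q + g (insert x Q)) := by
  rw [sum_add_distrib, ← sum_powerset_insert (notMem_erase x univ), insert_erase (mem_univ x),
    powerset_univ]

theorem qprob_true {V : Type} [Fintype V] (p : ℝ) : qprob (V := V) p (fun _ => True) = 1 := by
  simp [qprob, qweight, Fintype.sum_pow_mul_eq_add_pow]

/-- An event closed under removing `x` is nonnegatively correlated with `x ∉ Q`. -/
theorem mul_qprob_le_qprob_and_notMem {V : Type} [Fintype V] {p : ℝ} (hp0 : 0 ≤ p) (hp1 : p ≤ 1)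
    {B : Finset V → Prop} {x : V} (hB : ∀ Q, x ∉ Q → B (insert x Q) → B Q) :
    (1 - p) * qprob p B ≤ qprob p (fun Q => B Q ∧ x ∉ Q) := by
  rw [qprob, qprob, sum_finset_eq_sum_powerset_erase x, sum_finset_eq_sum_powerset_erase x,
    mul_sum]
  refine sum_le_sum fun Q hQ => ?_
  have hx : x ∉ Q := fun h => notMem_erase x univ (mem_powerset.1 hQ h)
  have h0 := qweight_nonneg hp0 hp1 Q
  have h1 := qweight_insert p hx
  have h2 := hB Q hx
  have h3 := mul_nonneg hp0 h0
  by_cases ha : B Q <;> by_cases hb : B (insert x Q) <;> simp [ha, hb, hx] <;> first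
    | exact absurd (h2 hb) ha
    | linarith

/-- An event closed under adding `x` is nonnegatively correlated with `x ∈ Q`. -/
theorem mul_qprob_le_qprob_and_mem {V : Type} [Fintype V] {p : ℝ} (hp0 : 0 ≤ p) (hp1 : p ≤ 1)
    {B : Finset V → Prop} {x : V} (hB : ∀ Q, x ∉ Q → B Q → B (insert x Q)) :
    p * qprob p B ≤ qprob p (fun Q => B Q ∧ x ∈ Q) := by
  rw [qprob, qprob, sum_finset_eq_sum_powerset_erase x, sum_finset_eq_sum_powerset_erase x,
    mul_sum]
  refine sum_le_sum fun Q hQ => ?_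
  have hx : x ∉ Q := fun h => notMem_erase x univ (mem_powerset.1 hQ h)
  have h0 := qweight_nonneg hp0 hp1 (insert x Q)
  have h1 := qweight_insert p hx
  have h2 := hB Q hx
  have h3 := mul_nonneg (sub_nonneg.2 hp1) h0
  by_cases ha : B Q <;> by_cases hb : B (insert x Q) <;> simp [ha, hb, hx] <;> first
    | exact absurd (h2 ha) hb
    | linarith

theorem pow_card_le_qprob_subset {V : Type} [Fintype V] {p : ℝ} (hp0 : 0 ≤ p) (hp1 : p ≤ 1)
    (e : Finset V) : p ^ e.card ≤ qprob p (fun Q => e ⊆ Q) := by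
  induction e using Finset.induction_on with
  | empty => simp [qprob_true]
  | insert x e hx ih =>
    rw [card_insert_of_notMem hx, pow_succ']
    calc p * p ^ e.card ≤ p * qprob p (fun Q => e ⊆ Q) := mul_le_mul_of_nonneg_left ih hp0
      _ ≤ qprob p (fun Q => e ⊆ Q ∧ x ∈ Q) :=
        mul_qprob_le_qprob_and_mem hp0 hp1 fun Q _ h => h.trans (subset_insert x Q)
      _ ≤ _ := qprob_mono hp0 hp1 fun Q h => insert_subset h.2 h.1

/-- If the event `B` is closed under removing vertices outside `e`, then avoiding any family of
sets, none of which is contained in `e`, costs at most a factor `1 - p` per set. -/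
theorem pow_card_mul_qprob_le_qprob_and_forall_not_subset {V ι : Type} [Fintype V] {p : ℝ}
    (hp0 : 0 ≤ p) (hp1 : p ≤ 1) (e : Finset V) {B : Finset V → Prop}
    (hB : ∀ x ∉ e, ∀ Q, x ∉ Q → B (insert x Q) → B Q)
    (f : ι → Finset V) (S : Finset ι) (hS : ∀ j ∈ S, ¬ f j ⊆ e) :
    (1 - p) ^ S.card * qprob p B ≤ qprob p (fun Q => B Q ∧ ∀ j ∈ S, ¬ f j ⊆ Q) := by
  induction S using Finset.induction_on with
  | empty => simp
  | insert k S hk ih =>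
    obtain ⟨x, hxf, hxe⟩ := not_subset.1 (hS k (mem_insert_self k S))
    rw [card_insert_of_notMem hk, pow_succ', mul_assoc]
    calc (1 - p) * ((1 - p) ^ S.card * qprob p B)
        ≤ (1 - p) * qprob p (fun Q => B Q ∧ ∀ j ∈ S, ¬ f j ⊆ Q) :=
          mul_le_mul_of_nonneg_left (ih fun j hj => hS j (mem_insert_of_mem hj))
            (sub_nonneg.2 hp1)
      _ ≤ qprob p (fun Q => (B Q ∧ ∀ j ∈ S, ¬ f j ⊆ Q) ∧ x ∉ Q) :=
          mul_qprob_le_qprob_and_notMem hp0 hp1 fun Q hx h =>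
            ⟨hB x hxe Q hx h.1, fun j hj hjQ => h.2 j hj (hjQ.trans (subset_insert x Q))⟩
      _ ≤ _ := qprob_mono hp0 hp1 fun Q h => ⟨h.1.1, fun j hj hjQ => by
          rcases mem_insert.1 hj with rfl | hj
          · exact h.2 (hjQ hxf)
          · exact h.1.2 j hj hjQ⟩

/-- Decomposition of an event according to the first of the sets `e i` contained in the query. -/
theorem qprob_exists_subset_and {V : Type} [Fintype V] (p : ℝ) {t : ℕ} (e : Fin t → Finset V)
    (C : Finset V → Prop) :
    qprob p (fun Q => (∃ i, e i ⊆ Q) ∧ C Q) =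
      ∑ i, qprob p (fun Q => (e i ⊆ Q ∧ ∀ j ∈ Iio i, ¬ e j ⊆ Q) ∧ C Q) := by
  unfold qprob
  rw [sum_comm]
  refine sum_congr rfl fun Q _ => ?_
  by_cases h : (∃ i, e i ⊆ Q) ∧ C Q
  · obtain ⟨⟨i, hi⟩, hC⟩ := h
    obtain ⟨k, hk, hmin⟩ := WellFounded.has_min (wellFounded_lt (α := Fin t))
      {i | e i ⊆ Q} ⟨i, hi⟩
    rw [if_pos ⟨⟨i, hi⟩, hC⟩, sum_eq_single k]
    · rw [if_pos ⟨⟨hk, fun j hj hjQ => hmin j hjQ (mem_Iio.1 hj)⟩, hC⟩]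
    · intro b _ hbk
      refine if_neg fun hb => ?_
      rcases lt_or_gt_of_ne hbk with hlt | hgt
      · exact hmin b hb.1.1 hlt
      · exact hb.1.2 k (mem_Iio.2 hgt) hk
    · exact fun hk => absurd (mem_univ k) hk
  · rw [if_neg h, sum_eq_zero]
    exact fun i _ => if_neg fun hi => h ⟨⟨i, hi.1.1⟩, hi.2⟩

theorem qprob_exists_subset {V : Type} [Fintype V] (p : ℝ) {t : ℕ} (e : Fin t → Finset V) :
    qprob p (fun Q => ∃ i, e i ⊆ Q) =
      ∑ i, qprob p (fun Q => e i ⊆ Q ∧ ∀ j ∈ Iio i, ¬ e j ⊆ Q) := by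
  simpa only [and_true] using qprob_exists_subset_and p e fun _ => True

theorem subset_of_subset_insert_of_notMem {V : Type} {e Q : Finset V} {x : V} (hx : x ∉ e)
    (h : e ⊆ insert x Q) : e ⊆ Q :=
  (subset_insert_iff_of_notMem hx).1 h

theorem mul_one_sub_pow_le_qprob_exists_subset {V : Type} [Fintype V] {p : ℝ}
    (hp0 : 0 ≤ p) (hp1 : p ≤ 1) {t : ℕ} (e : Fin t → Finset V)
    (hc : ∀ i, (e i).card = 2) (hinj : Function.Injective e) :
    p * (1 - (1 - p) ^ t) ≤ qprob p (fun Q => ∃ i, e i ⊆ Q) := by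
  rw [qprob_exists_subset]
  calc p * (1 - (1 - p) ^ t) = ∑ i : Fin t, (1 - p) ^ (i : ℕ) * p ^ 2 := by
        rw [← sum_mul, Fin.sum_univ_eq_sum_range (fun i => (1 - p) ^ i)]
        linear_combination p * geom_sum_mul (1 - p) t
    _ ≤ _ := sum_le_sum fun i _ => ?_
  have key := pow_card_mul_qprob_le_qprob_and_forall_not_subset hp0 hp1 (e i)
    (B := fun Q => e i ⊆ Q) (fun x hx Q _ h => subset_of_subset_insert_of_notMem hx h) e (Iio i)
    (fun j hj hji => (mem_Iio.1 hj).ne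
      (hinj (eq_of_subset_of_card_le hji (by rw [hc, hc]))))
  rw [Fin.card_Iio] at key
  refine le_trans (mul_le_mul_of_nonneg_left ?_ (pow_nonneg (sub_nonneg.2 hp1) _)) key
  simpa only [hc] using pow_card_le_qprob_subset hp0 hp1 (e i)

theorem indepIn_of_forall_not_toFinset_subset {V : Type} [Fintype V] {G : SimpleGraph V}
    [DecidableRel G.Adj] {Q : Finset V} (h : ∀ s ∈ G.edgeFinset, ¬ s.toFinset ⊆ Q) :
    indepIn G Q := by
  intro u hu v hv huv
  refine h s(u, v) (by simpa using huv) fun w hw => ?_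
  rcases Sym2.mem_iff.1 (Sym2.mem_toFinset.1 hw) with rfl | rfl <;> assumption

theorem qprob_mul_pow_le_qprob_and_indepIn {V : Type} [Fintype V] (G : SimpleGraph V)
    [DecidableRel G.Adj] {p : ℝ} (hp0 : 0 ≤ p) (hp1 : p ≤ 1) {t : ℕ} (e : Fin t → Finset V)
    (he : ∀ i, indepIn G (e i)) :
    qprob p (fun Q => ∃ i, e i ⊆ Q) * (1 - p) ^ G.edgeFinset.card ≤
      qprob p (fun Q => (∃ i, e i ⊆ Q) ∧ indepIn G Q) := by
  rw [qprob_exists_subset_and, qprob_exists_subset, mul_comm, mul_sum]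
  refine sum_le_sum fun i _ => ?_
  refine (pow_card_mul_qprob_le_qprob_and_forall_not_subset hp0 hp1 (e i) ?_
    (fun s : Sym2 V => s.toFinset) G.edgeFinset ?_).trans
    (qprob_mono hp0 hp1 fun Q h => ⟨h.1, indepIn_of_forall_not_toFinset_subset h.2⟩)
  · exact fun x hx Q _ h => ⟨subset_of_subset_insert_of_notMem hx h.1,
      fun j hj hjQ => h.2 j hj (hjQ.trans (subset_insert x Q))⟩
  · intro s hs hsub
    induction s with
    | _ u v =>
      exact he i u (hsub (by simp)) v (hsub (by simp)) (by simpa using hs)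

theorem stmt10 {V : Type} [Fintype V] [DecidableEq V]
    (G : SimpleGraph V) [DecidableRel G.Adj]
    (m : ℕ) (hm : G.edgeFinset.card = m)
    (t : ℕ) (ht : 1 ≤ t) (e' : Fin t → Finset V)
    (hc : ∀ i, (e' i).card = 2) (hinj : Function.Injective e')
    (hnotE : ∀ i, ∀ u ∈ e' i, ∀ v ∈ e' i, ¬ G.Adj u v)
    (p : ℝ) (hp0 : 0 < p) (hp1 : p < 1)
    (q : ℝ) (hq : q ≤ qprob p (fun Q => ∃ i, e' i ⊆ Q)) :
    q * (1 - p) ^ m ≤ qprob p (fun Q => (∃ i, e' i ⊆ Q) ∧ indepIn G Q) ∧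
    p * (1 - (1 - p) ^ t) * (1 - p) ^ m ≤
      qprob p (fun Q => (∃ i, e' i ⊆ Q) ∧ indepIn G Q) := by
  have hmain : ∀ r, r ≤ qprob p (fun Q => ∃ i, e' i ⊆ Q) →
      r * (1 - p) ^ m ≤ qprob p (fun Q => (∃ i, e' i ⊆ Q) ∧ indepIn G Q) := by
    intro r hr
    refine (mul_le_mul_of_nonneg_right hr (pow_nonneg (sub_nonneg.2 hp1.le) m)).trans ?_
    rw [← hm]
    convert qprob_mul_pow_le_qprob_and_indepIn G hp0.le hp1.le e' hnotE
  exact ⟨hmain q hq,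
    hmain _ (mul_one_sub_pow_le_qprob_exists_subset hp0.le hp1.le e' hc hinj)⟩
end

section
/- There is an absolute constant C such that for all integers n ≥ 2 and m ≥ 1 there exist an integer t ≤ C·m²·log n and subsets Q_1, …, Q_t of [n] with the following property: for every simple graph G on vertex set [n] with at most m edges and every set E' of m two-element subsets of [n] none of which is an edge of G, there exists j ∈ [t] such that Q_j is an independent set of G and e ⊆ Q_j for some e ∈ E'. -/
open Finset

/-- Greedy covering: if every `x ∈ T` is hit by at least a `δ`-fraction of `Ω`, then some `t` elements
of `Ω` leave at most a `(1 - δ) ^ t`-fraction of `T` unhit. -/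
theorem exists_tuple_card_unhit_le {Ω P : Type*} [Fintype Ω] [Nonempty Ω] (r : Ω → P → Prop)
    (T : Finset P) (δ : ℝ) (hδ : δ ≤ 1)
    (h : ∀ x ∈ T, δ * Fintype.card Ω ≤ ∑ ω, (open Classical in if r ω x then (1 : ℝ) else 0))
    (t : ℕ) :
    ∃ q : Fin t → Ω, (∑ x ∈ T, (open Classical in if ∀ j, ¬ r (q j) x then (1 : ℝ) else 0)) ≤
      (1 - δ) ^ t * #T := by
  classical
  induction t with
  | zero => exact ⟨Fin.elim0, by simp⟩
  | succ t ih =>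
    obtain ⟨q, hq⟩ := ih
    set S := ∑ x ∈ T, (if ∀ j, ¬ r (q j) x then (1 : ℝ) else 0) with hS
    obtain ⟨ω, -, hω⟩ : ∃ ω ∈ (univ : Finset Ω),
        (∑ x ∈ T, (if ∀ j, ¬ r (q j) x then (1 : ℝ) else 0) * (if r ω x then 0 else 1)) ≤
          (1 - δ) * S := by
      refine exists_le_of_sum_le univ_nonempty ?_
      rw [sum_comm, sum_const, card_univ, nsmul_eq_mul, hS, mul_sum, mul_sum]
      refine sum_le_sum fun x hx ↦ ?_
      rw [← mul_sum]
      have h1 : ∑ ω, (if r ω x then (0 : ℝ) else 1) =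
          Fintype.card Ω - ∑ ω, (if r ω x then (1 : ℝ) else 0) := by
        rw [eq_sub_iff_add_eq, ← sum_add_distrib,
          sum_congr rfl fun ω _ ↦ show _ = (1 : ℝ) by split_ifs <;> norm_num]
        simp
      have h2 := h x hx
      rw [h1]
      split_ifs
      · linarith
      · simp
    refine ⟨Fin.cons ω q, ?_⟩
    calc _ = ∑ x ∈ T, (if ∀ j, ¬ r (q j) x then (1 : ℝ) else 0) * (if r ω x then 0 else 1) := by
          refine sum_congr rfl fun x _ ↦ ?_
          simp only [Fin.forall_fin_succ, Fin.cons_zero, Fin.cons_succ]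
          by_cases h1 : r ω x <;> simp [h1]
      _ ≤ (1 - δ) * S := hω
      _ ≤ (1 - δ) * ((1 - δ) ^ t * #T) := mul_le_mul_of_nonneg_left hq (by linarith)
      _ = _ := by ring

/-- The set of points at which `f` vanishes. -/
def vanishingSet {V : Type*} [Fintype V] {K : ℕ} (f : V → Fin K) : Finset V :=
  {v | (f v : ℕ) = 0}

theorem sum_ite_subset_vanishingSet {V : Type*} [Fintype V] [DecidableEq V] {K : ℕ} (hK : 0 < K)
    (S : Finset V) :
    ∑ f : V → Fin K, (if S ⊆ vanishingSet f then (1 : ℝ) else 0) =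
      K ^ Fintype.card V * (1 / K : ℝ) ^ #S := by
  have : NeZero K := ⟨hK.ne'⟩
  have h1 : (univ.filter fun f : V → Fin K ↦ S ⊆ vanishingSet f) =
      Fintype.piFinset fun v ↦ if v ∈ S then {0} else univ := by
    ext f
    simp only [mem_filter, mem_univ, true_and, Fintype.mem_piFinset, subset_iff, vanishingSet]
    refine forall_congr' fun v ↦ ?_
    by_cases hv : v ∈ S <;> simp [hv]
  rw [sum_boole, h1, Fintype.card_piFinset]
  have h2 : ∀ v, #(if v ∈ S then ({0} : Finset (Fin K)) else univ) = if v ∈ S then 1 else K := by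
    intro v; split_ifs <;> simp
  have h3 : #S ≤ Fintype.card V := card_le_univ S
  have hK' : (K : ℝ) ≠ 0 := by positivity
  simp only [h2, prod_ite, prod_const, one_pow, one_mul]
  have h4 : #(univ.filter fun v ↦ v ∉ S) + #S = Fintype.card V := by
    rw [← card_compl_add_card S]
    congr 2
    ext; simp
  rw [← h4, pow_add, one_div, inv_pow]
  push_cast
  field_simp

theorem three_le_card_union {V : Type*} [DecidableEq V] {d e : Finset V} (hd : #d = 2) (he : #e = 2)
    (h : d ≠ e) : 3 ≤ #(d ∪ e) := by
  by_contra! h1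
  have h2 : d = d ∪ e := eq_of_subset_of_card_le subset_union_left (by omega)
  have h3 : e = d ∪ e := eq_of_subset_of_card_le subset_union_right (by omega)
  exact h (h2.trans h3.symm)

/-- `Q` contains no member of `D` but contains some member of `E`. -/
def Separates {V : Type*} (D E : Finset (Finset V)) (Q : Finset V) : Prop :=
  (∀ d ∈ D, ¬ d ⊆ Q) ∧ ∃ e ∈ E, e ⊆ Q

theorem sum_sub_sum_le_ite_separates {V : Type*} [DecidableEq V] (D E : Finset (Finset V))
    (Q : Finset V) :
    ∑ e ∈ E, (if e ⊆ Q then (1 : ℝ) else 0) -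
      ∑ e ∈ E, ∑ d ∈ D, (if e ∪ d ⊆ Q then (1 : ℝ) else 0) -
      ∑ e ∈ E, ∑ e' ∈ E.erase e, (if e ∪ e' ⊆ Q then (1 : ℝ) else 0) ≤
    (open Classical in if Separates D E Q then (1 : ℝ) else 0) := by
  have hu : ∀ a b : Finset V, (if a ∪ b ⊆ Q then (1 : ℝ) else 0) =
      (if a ⊆ Q then 1 else 0) * (if b ⊆ Q then 1 else 0) := by
    intro a b
    simp only [union_subset_iff]
    split_ifs <;> simp_all
  have he : ∀ e ∈ E, ∑ e' ∈ E.erase e, (if e ∪ e' ⊆ Q then (1 : ℝ) else 0) =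
      (if e ⊆ Q then 1 else 0) * ((∑ e' ∈ E, if e' ⊆ Q then 1 else 0) - 1) := by
    intro e hE
    simp only [hu, ← mul_sum]
    rw [← add_sum_erase _ _ hE]
    split_ifs <;> simp
  rw [sum_congr rfl he, ← sum_mul]
  simp only [hu, ← mul_sum, ← sum_mul]
  rw [sum_boole, sum_boole]
  generalize hx : #(E.filter (· ⊆ Q)) = x
  generalize hy : #(D.filter (· ⊆ Q)) = y
  have hx0 : x ≠ 0 → ∃ e ∈ E, e ⊆ Q := by
    intro h
    rw [← hx, card_ne_zero] at h
    obtain ⟨e, h⟩ := h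
    exact ⟨e, by simpa using h⟩
  have hy0 : y = 0 → ∀ d ∈ D, ¬ d ⊆ Q := by
    intro h
    rw [← hy, card_eq_zero, filter_eq_empty_iff] at h
    exact fun d hd ↦ h hd
  have h01 : (0 : ℝ) ≤ (open Classical in if Separates D E Q then (1 : ℝ) else 0) := by
    split_ifs <;> simp
  rcases Nat.eq_zero_or_pos x with rfl | hxp
  · simpa using h01
  have hx1 : (1 : ℝ) ≤ x := by exact_mod_cast hxp
  rcases Nat.eq_zero_or_pos y with rfl | hyp
  · rw [if_pos ⟨hy0 rfl, hx0 hxp.ne'⟩]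
    push_cast
    nlinarith [sq_nonneg ((x : ℝ) - 1)]
  · have hy1 : (1 : ℝ) ≤ y := by exact_mod_cast hyp
    nlinarith [mul_nonneg (sub_nonneg.2 hx1) (sub_nonneg.2 hy1)]

theorem card_le_sum_ite_separates {V : Type*} [Fintype V] [DecidableEq V] {m : ℕ} (hm : 1 ≤ m)
    (D E : Finset (Finset V)) (hD : ∀ d ∈ D, #d = 2) (hE : ∀ e ∈ E, #e = 2) (hDm : #D ≤ m)
    (hEm : #E = m) (hDE : Disjoint D E) :
    1 / (32 * m : ℝ) * Fintype.card (V → Fin (4 * m)) ≤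
      ∑ f : V → Fin (4 * m),
        (open Classical in if Separates D E (vanishingSet f) then (1 : ℝ) else 0) := by
  have hK : 0 < 4 * m := by omega
  have hm0 : (0 : ℝ) < m := by exact_mod_cast hm
  refine le_trans ?_ (sum_le_sum fun f _ ↦ sum_sub_sum_le_ite_separates D E (vanishingSet f))
  rw [sum_sub_distrib, sum_sub_distrib, sum_comm]
  have hc : (Fintype.card (V → Fin (4 * m)) : ℝ) = ((4 * m : ℕ) : ℝ) ^ Fintype.card V := by simp
  set N : ℝ := ((4 * m : ℕ) : ℝ) ^ Fintype.card V with hN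
  set p : ℝ := 1 / ((4 * m : ℕ) : ℝ) with hp
  have hN0 : 0 ≤ N := by positivity
  have hp0 : 0 ≤ p := by positivity
  have hp1 : p ≤ 1 := by
    rw [hp, div_le_one (by positivity)]
    exact_mod_cast hK
  have hpair : ∀ a b : Finset V, #a = 2 → #b = 2 → a ≠ b →
      ∑ f : V → Fin (4 * m), (if a ∪ b ⊆ vanishingSet f then (1 : ℝ) else 0) ≤ N * p ^ 3 := by
    intro a b ha hb hab
    rw [sum_ite_subset_vanishingSet hK]
    exact mul_le_mul_of_nonneg_left
      (pow_le_pow_of_le_one hp0 hp1 (three_le_card_union ha hb hab)) hN0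
  have h1 : ∑ e ∈ E, ∑ f : V → Fin (4 * m), (if e ⊆ vanishingSet f then (1 : ℝ) else 0) =
      m * (N * p ^ 2) := by
    rw [sum_congr rfl fun e he ↦ by rw [sum_ite_subset_vanishingSet hK, hE e he], sum_const, hEm,
      nsmul_eq_mul]
  have h2 : ∀ F : Finset V → Finset (Finset V),
      (∀ e ∈ E, #(F e) ≤ m ∧ ∀ d ∈ F e, #d = 2 ∧ e ≠ d) →
      ∑ f : V → Fin (4 * m), ∑ e ∈ E, ∑ d ∈ F e,
        (if e ∪ d ⊆ vanishingSet f then (1 : ℝ) else 0) ≤ m * (m * (N * p ^ 3)) := by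
    intro F hF
    rw [sum_comm]
    have : ∀ e ∈ E, ∑ f : V → Fin (4 * m), ∑ d ∈ F e,
        (if e ∪ d ⊆ vanishingSet f then (1 : ℝ) else 0) ≤ m * (N * p ^ 3) := by
      intro e he
      rw [sum_comm]
      refine (sum_le_card_nsmul _ _ _ fun d hd ↦
        hpair e d (hE e he) ((hF e he).2 d hd).1 ((hF e he).2 d hd).2).trans ?_
      rw [nsmul_eq_mul]
      exact mul_le_mul_of_nonneg_right (by exact_mod_cast (hF e he).1) (by positivity)
    refine (sum_le_card_nsmul _ _ _ this).trans ?_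
    rw [nsmul_eq_mul, hEm]
  have h3 := h2 (fun _ ↦ D) fun e he ↦
    ⟨hDm, fun d hd ↦ ⟨hD d hd, fun h ↦ disjoint_left.1 hDE hd (h ▸ he)⟩⟩
  have h4 := h2 (fun e ↦ E.erase e) fun e he ↦
    ⟨(card_erase_le).trans hEm.le, fun d hd ↦ ⟨hE d (mem_of_mem_erase hd), (ne_of_mem_erase hd).symm⟩⟩
  rw [h1, hc]
  have h5 : 1 / (32 * m : ℝ) * N = m * (N * p ^ 2) - m * (m * (N * p ^ 3)) - m * (m * (N * p ^ 3)) := by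
    rw [hp]
    push_cast
    field_simp
    ring
  linarith

theorem card_filter_powerset_card_le {α : Type*} [DecidableEq α] (P : Finset α) (m : ℕ) :
    #(P.powerset.filter (#· ≤ m)) ≤ (#P + 1) ^ m := by
  have h : P.powerset.filter (#· ≤ m) ⊆ (range (m + 1)).biUnion fun k ↦ P.powersetCard k := by
    intro D hD
    simp only [mem_filter, mem_powerset] at hD
    simp only [mem_biUnion, mem_range, mem_powersetCard]
    exact ⟨#D, by omega, hD.1, rfl⟩
  refine (card_le_card h).trans (card_biUnion_le.trans ?_)
  rw [add_pow]
  refine sum_le_sum fun k hk ↦ ?_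
  rw [card_powersetCard, one_pow, mul_one]
  exact (Nat.choose_le_pow _ _).trans
    (Nat.le_mul_of_pos_right _ (Nat.choose_pos (by simpa [Nat.lt_succ_iff] using hk)))

theorem card_powersetCard_two_add_one_le {n : ℕ} (hn : 2 ≤ n) :
    #((univ : Finset (Fin n)).powersetCard 2) + 1 ≤ n ^ 2 := by
  rw [card_powersetCard, card_univ, Fintype.card_fin]
  have h := Nat.choose_two_right n
  have h1 : n * (n - 1) / 2 ≤ n * (n - 1) := Nat.div_le_self _ _
  obtain ⟨k, rfl⟩ := Nat.exists_eq_add_of_le hn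
  have h2 : 2 + k - 1 = 1 + k := by omega
  rw [h2] at h h1
  nlinarith

theorem exists_separating_family {n m : ℕ} (hn : 2 ≤ n) (hm : 1 ≤ m) :
    ∃ t : ℕ, (t : ℝ) ≤ 130 * m ^ 2 * Real.log n ∧
      ∃ Q : Fin t → Finset (Fin n), ∀ D E : Finset (Finset (Fin n)),
        (∀ d ∈ D, #d = 2) → (∀ e ∈ E, #e = 2) → #D ≤ m → #E = m → Disjoint D E →
          ∃ j, Separates D E (Q j) := by
  classical
  have hm1 : (1 : ℝ) ≤ m := by exact_mod_cast hm
  have hm0 : (0 : ℝ) < m := by linarith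
  have hn0 : (0 : ℝ) < n := by exact_mod_cast (by omega : 0 < n)
  have hlog : (1 / 2 : ℝ) ≤ Real.log n := by
    have h1 : Real.log 2 ≤ Real.log n := Real.log_le_log (by norm_num) (by exact_mod_cast hn)
    linarith [Real.log_two_gt_d9]
  have hml : 1 ≤ 2 * (m : ℝ) ^ 2 * Real.log n := by
    nlinarith [mul_le_mul (one_le_pow₀ hm1 (n := 2)) hlog (by norm_num) (by positivity)]
  have hx0 : 0 ≤ 128 * (m : ℝ) ^ 2 * Real.log n := by linarith
  set t := ⌊128 * (m : ℝ) ^ 2 * Real.log n⌋₊ + 1 with ht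
  have htl : 128 * (m : ℝ) ^ 2 * Real.log n < t := by
    rw [ht]; push_cast; exact Nat.lt_floor_add_one _
  have htu : (t : ℝ) ≤ 130 * m ^ 2 * Real.log n := by
    have := Nat.floor_le hx0
    rw [ht]; push_cast; linarith
  refine ⟨t, htu, ?_⟩
  let A := ((univ : Finset (Fin n)).powersetCard 2).powerset.filter (#· ≤ m)
  have hA : #A ≤ n ^ (2 * m) := by
    rw [pow_mul]
    exact (card_filter_powerset_card_le _ _).trans
      (Nat.pow_le_pow_left (card_powersetCard_two_add_one_le hn) _)
  let T := (A ×ˢ A).filter fun x ↦ #x.2 = m ∧ Disjoint x.1 x.2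
  have hT : (#T : ℝ) ≤ (n : ℝ) ^ (4 * m) := by
    have h1 : #T ≤ n ^ (2 * m) * n ^ (2 * m) :=
      (card_filter_le _ _).trans ((card_product A A).trans_le (Nat.mul_le_mul hA hA))
    rw [← pow_add, ← two_mul, ← mul_assoc] at h1
    exact_mod_cast h1
  have hmemA : ∀ D, D ∈ A ↔ (∀ d ∈ D, #d = 2) ∧ #D ≤ m := by
    intro D
    simp [A, subset_iff, mem_powersetCard]
  have : NeZero (4 * m) := ⟨by omega⟩
  have hδ : 1 / (32 * m : ℝ) ≤ 1 := by
    rw [div_le_one (by positivity)]; linarith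
  obtain ⟨q, hq⟩ := exists_tuple_card_unhit_le
    (fun (f : Fin n → Fin (4 * m)) (x : Finset (Finset (Fin n)) × Finset (Finset (Fin n))) ↦
      Separates x.1 x.2 (vanishingSet f)) T (1 / (32 * m)) hδ (by
      rintro ⟨D, E⟩ hx
      simp only [T, mem_filter, mem_product, hmemA] at hx
      exact card_le_sum_ite_separates hm D E hx.1.1.1 hx.1.2.1 hx.1.1.2 hx.2.1 hx.2.2) t
  have hlt : (1 - 1 / (32 * m : ℝ)) ^ t * #T < 1 := by
    have h1 : (1 - 1 / (32 * m : ℝ)) ^ t ≤ Real.exp (-(t / (32 * m))) := by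
      have h2 := Real.add_one_le_exp (-(1 / (32 * m : ℝ)))
      calc (1 - 1 / (32 * m : ℝ)) ^ t ≤ Real.exp (-(1 / (32 * m : ℝ))) ^ t :=
            pow_le_pow_left₀ (by linarith) (by linarith) _
        _ = _ := by rw [← Real.exp_nat_mul]; congr 1; ring
    have h3 : (n : ℝ) ^ (4 * m) = Real.exp (4 * m * Real.log n) := by
      rw [← Real.exp_log (pow_pos hn0 (4 * m)), Real.log_pow]
      push_cast; rfl
    calc _ ≤ Real.exp (-(t / (32 * m))) * Real.exp (4 * m * Real.log n) :=
          mul_le_mul h1 (hT.trans h3.le) (by positivity) (by positivity)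
      _ = Real.exp (-(t / (32 * m)) + 4 * m * Real.log n) := by rw [Real.exp_add]
      _ < 1 := by
        rw [Real.exp_lt_one_iff]
        have : 4 * m * Real.log n < t / (32 * m) := by
          rw [lt_div_iff₀ (by positivity)]; linarith
        linarith
  refine ⟨fun j ↦ vanishingSet (q j), fun D E hD hE hDm hEm hDE ↦ ?_⟩
  by_contra! hcon
  have hmem : (D, E) ∈ T := by
    simp only [T, mem_filter, mem_product, hmemA]
    exact ⟨⟨⟨hD, hDm⟩, hE, hEm.le⟩, hEm, hDE⟩
  have hone := single_le_sum
    (f := fun x : Finset (Finset (Fin n)) × Finset (Finset (Fin n)) ↦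
      if ∀ j, ¬ Separates x.1 x.2 (vanishingSet (q j)) then (1 : ℝ) else 0)
    (fun x _ ↦ by split_ifs <;> simp) hmem
  simp only [if_pos hcon] at hone
  exact absurd (hone.trans hq) (not_le.2 hlt)

theorem stmt11 :
    ∃ C : ℝ, 0 < C ∧ ∀ n m : ℕ, 2 ≤ n → 1 ≤ m →
      ∃ t : ℕ, (t : ℝ) ≤ C * m ^ 2 * Real.log n ∧
        ∃ Q : Fin t → Finset (Fin n),
          ∀ G : SimpleGraph (Fin n), G.edgeSet.ncard ≤ m →
            ∀ E' : Finset (Finset (Fin n)), E'.card = m →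
              (∀ e ∈ E', e.card = 2 ∧ ∀ u ∈ e, ∀ v ∈ e, ¬ G.Adj u v) →
              ∃ j : Fin t, (∀ u ∈ Q j, ∀ v ∈ Q j, ¬ G.Adj u v) ∧ ∃ e ∈ E', e ⊆ Q j := by
  refine ⟨130, by norm_num, fun n m hn hm ↦ ?_⟩
  obtain ⟨t, ht, Q, hQ⟩ := exists_separating_family hn hm
  refine ⟨t, ht, Q, fun G hG E' hE' hGE ↦ ?_⟩
  classical
  let D : Finset (Finset (Fin n)) := G.edgeFinset.image Sym2.toFinset
  have hD : ∀ d, d ∈ D ↔ ∃ u v, G.Adj u v ∧ {u, v} = d := by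
    intro d
    simp [D, Sym2.exists, Sym2.toFinset_mk_eq]
  have hDm : #D ≤ m := by
    refine card_image_le.trans ?_
    rwa [← Set.ncard_coe_finset, SimpleGraph.coe_edgeFinset]
  obtain ⟨j, hj, hj'⟩ := hQ D E'
    (fun d hd ↦ by
      obtain ⟨u, v, huv, rfl⟩ := (hD d).1 hd
      exact card_pair huv.ne)
    (fun e he ↦ (hGE e he).1) hDm hE'
    (disjoint_left.2 fun d hd he ↦ by
      obtain ⟨u, v, huv, rfl⟩ := (hD d).1 hd
      exact (hGE _ he).2 u (by simp) v (by simp) huv)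
  refine ⟨j, fun u hu v hv huv ↦ hj {u, v} ((hD _).2 ⟨u, v, huv, rfl⟩) ?_, hj'⟩
  simp [insert_subset_iff, hu, hv]
end

section
/- Let t, n, w, m be positive integers and let M be a t×n matrix with entries in [w] such that any two distinct columns of M agree in at most t/(2m) entries. Let E be a set of at most m two-element subsets of [n]. Then there exists a row index u ∈ [t] such that for every pair {i,j} ∈ E we have M_{u,i} ≠ M_{u,j}; equivalently, the partition of [n] into the sets S_{u,k} = {j : M_{u,j} = k}, k ∈ [w], separates the endpoints of every pair in E. -/
open Finset

theorem stmt12 (t n w m : ℕ) (ht : 0 < t) (hn : 0 < n) (hw : 0 < w) (hm : 0 < m)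
    (M : Fin t → Fin n → Fin w)
    (hagree : ∀ i j : Fin n, i ≠ j →
      ((Finset.univ.filter fun u : Fin t => M u i = M u j).card : ℝ) ≤ (t : ℝ) / (2 * m))
    (E : Finset (Finset (Fin n))) (hE : E.card ≤ m) (hE2 : ∀ e ∈ E, e.card = 2) :
    ∃ u : Fin t, ∀ e ∈ E, ∀ i ∈ e, ∀ j ∈ e, i ≠ j → M u i ≠ M u j := by
  classical
  by_contra! hcon
  let bad : Finset (Fin n) → Finset (Fin t) := fun e =>
    Finset.univ.filter fun u => ∃ i ∈ e, ∃ j ∈ e, i ≠ j ∧ M u i = M u j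
  have hbad : ∀ e ∈ E, ((bad e).card : ℝ) ≤ (t : ℝ) / (2 * m) := by
    intro e he
    obtain ⟨a, b, hab, rfl⟩ := Finset.card_eq_two.mp (hE2 e he)
    refine le_trans ?_ (hagree a b hab)
    gcongr
    intro u hu
    simp only [bad, Finset.mem_filter_univ, Finset.mem_insert, Finset.mem_singleton] at hu ⊢
    grind
  have hcover : (Finset.univ : Finset (Fin t)) ⊆ E.biUnion bad := by
    intro u _
    obtain ⟨e, he, i, hi, j, hj, hij, h⟩ := hcon u
    simp only [bad, Finset.mem_biUnion, Finset.mem_filter_univ]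
    exact ⟨e, he, i, hi, j, hj, hij, h⟩
  have hcard : t ≤ ∑ e ∈ E, (bad e).card := by
    simpa using (Finset.card_le_card hcover).trans Finset.card_biUnion_le
  have htR : (0 : ℝ) < t := by exact_mod_cast ht
  have hmR : (0 : ℝ) < m := by exact_mod_cast hm
  have hlt : (t : ℝ) ≤ t / 2 := calc
    (t : ℝ) ≤ ∑ e ∈ E, ((bad e).card : ℝ) := by exact_mod_cast hcard
    _ ≤ E.card * ((t : ℝ) / (2 * m)) := by
      simpa using Finset.sum_le_card_nsmul E _ _ hbad
    _ ≤ m * ((t : ℝ) / (2 * m)) := by gcongr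
    _ = t / 2 := by field_simp
  linarith
end

section
/- Let G be a simple graph with m edges, where m ≥ 1, and let p* ∈ [0,1] satisfy N_G(p*) = 1/2. Then 1/√(2m) ≤ p* ≤ 1/√2. -/
open Finset
open scoped Classical

/-- `N_G(p)`: the probability that a `p`-random query is independent in `G`. -/
noncomputable def NG {V : Type} [Fintype V] (G : SimpleGraph V) (p : ℝ) : ℝ :=
  qprob p (fun Q => indepIn G Q)

/-- A `p`-random query contains a given set `T` with probability `p ^ T.card`. -/
theorem qprob_superset {V : Type} [Fintype V] (p : ℝ) (T : Finset V) :
    qprob p (fun Q => T ⊆ Q) = p ^ T.card := by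
  have h := Finset.prod_add (fun _ : V => p) (fun i => if i ∈ T then 0 else 1 - p) univ
  have hl : ∏ i : V, (p + if i ∈ T then 0 else 1 - p) = p ^ T.card := by
    rw [← Finset.prod_const, ← Finset.prod_subset (Finset.subset_univ T)]
    · exact Finset.prod_congr rfl fun i hi => by simp [hi]
    · intro i _ hi
      simp [hi]
  rw [← hl, h, Finset.powerset_univ]
  refine Finset.sum_congr rfl fun Q _ => ?_
  split_ifs with hQ
  · have hc : ∏ i ∈ univ \ Q, (if i ∈ T then 0 else 1 - p) = ∏ _i ∈ univ \ Q, (1 - p) :=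
      Finset.prod_congr rfl fun i hi => if_neg fun hT => (Finset.mem_sdiff.1 hi).2 (hQ hT)
    rw [hc, Finset.prod_const, Finset.prod_const, Finset.card_univ_sdiff, qweight]
  · obtain ⟨i, hT, hi⟩ := Finset.not_subset.1 hQ
    rw [Finset.prod_eq_zero (i := i) (s := univ \ Q) (by simp [hi]) (by simp [hT]), mul_zero]

theorem qprob_add_qprob_not {V : Type} [Fintype V] (p : ℝ) (A : Finset V → Prop) :
    qprob p A + qprob p (fun Q => ¬ A Q) = 1 := by
  have h := qprob_superset (V := V) p ∅
  rw [Finset.card_empty, pow_zero] at h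
  rw [← h, qprob, qprob, qprob, ← Finset.sum_add_distrib]
  refine Finset.sum_congr rfl fun Q _ => ?_
  by_cases hA : A Q <;> simp [hA]

theorem NG_le_one_sub_sq {V : Type} [Fintype V] {G : SimpleGraph V} {u v : V}
    (huv : G.Adj u v) {p : ℝ} (hp0 : 0 ≤ p) (hp1 : p ≤ 1) : NG G p ≤ 1 - p ^ 2 := by
  have h1 := qprob_add_qprob_not p (indepIn G)
  have h2 : qprob p (fun Q => ({u, v} : Finset V) ⊆ Q) ≤ qprob p (fun Q => ¬ indepIn G Q) :=
    qprob_mono hp0 hp1 fun Q hQ hI => hI u (hQ (by simp)) v (hQ (by simp)) huv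
  rw [qprob_superset, Finset.card_pair huv.ne] at h2
  change qprob p (indepIn G) ≤ _
  linarith

theorem one_sub_card_edgeFinset_mul_sq_le_NG {V : Type} [Fintype V] (G : SimpleGraph V)
    [Fintype G.edgeSet] {p : ℝ} (hp0 : 0 ≤ p) (hp1 : p ≤ 1) :
    1 - G.edgeFinset.card * p ^ 2 ≤ NG G p := by
  have h1 := qprob_add_qprob_not p (indepIn G)
  have h2 : qprob p (fun Q => ¬ indepIn G Q) ≤
      qprob p (fun Q => ∃ e ∈ G.edgeFinset, e.toFinset ⊆ Q) := by
    refine qprob_mono hp0 hp1 fun Q hQ => ?_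
    simp only [indepIn, not_forall, not_not] at hQ
    obtain ⟨u, hu, v, hv, huv⟩ := hQ
    refine ⟨s(u, v), by simpa using huv, fun x hx => ?_⟩
    rcases Sym2.mem_iff.1 (Sym2.mem_toFinset.1 hx) with rfl | rfl <;> assumption
  have h3 := qprob_exists_le hp0 hp1 G.edgeFinset (fun e Q => e.toFinset ⊆ Q)
  have h4 : ∑ e ∈ G.edgeFinset, qprob p (fun Q => e.toFinset ⊆ Q) =
      G.edgeFinset.card * p ^ 2 := by
    rw [← nsmul_eq_mul]
    refine Finset.sum_eq_card_nsmul fun e he => ?_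
    rw [qprob_superset, Sym2.card_toFinset_of_not_isDiag e
      (G.not_isDiag_of_mem_edgeFinset he)]
  change _ ≤ qprob p (indepIn G)
  linarith

theorem stmt15 {V : Type} [Fintype V] [DecidableEq V]
    (G : SimpleGraph V) [DecidableRel G.Adj]
    (m : ℕ) (hm1 : 1 ≤ m) (hm : G.edgeFinset.card = m)
    (pstar : ℝ) (hp0 : 0 ≤ pstar) (hp1 : pstar ≤ 1) (hN : NG G pstar = 1 / 2) :
    1 / Real.sqrt (2 * m) ≤ pstar ∧ pstar ≤ 1 / Real.sqrt 2 := by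
  constructor
  · have h := one_sub_card_edgeFinset_mul_sq_le_NG G hp0 hp1
    rw [hN, hm] at h
    have hm0 : (0 : ℝ) < m := by exact_mod_cast hm1
    rw [← Real.sqrt_one, ← Real.sqrt_div zero_le_one, Real.sqrt_le_left hp0,
      div_le_iff₀ (by positivity)]
    linarith
  · obtain ⟨e, he⟩ := Finset.card_pos.1 (hm ▸ hm1 : 0 < G.edgeFinset.card)
    induction e with | _ u v
    have h := NG_le_one_sub_sq (by simpa using he : G.Adj u v) hp0 hp1
    rw [hN] at h
    rw [← Real.sqrt_one, ← Real.sqrt_div zero_le_one]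
    exact Real.le_sqrt_of_sq_le (by linarith)
end
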